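/- arXiv:2404.00427 — 8 statements merged into one kernel-verified Lean document; each statement's English description precedes it below -/
import Mathlib

section
/- For every m ≥ 1 and every choice of m pairwise distinct points x¹, …, x^m in ℝ^d, the Laplace kernel matrix M = [exp(−‖x^i − x^j‖)]_{1≤i,j≤m} is symmetric positive definite; that is, for every nonzero vector c ∈ ℝ^m one has ∑_{i,j} c_i c_j exp(−‖x^i − x^j‖) > 0. -/
open MeasureTheory Filter Topology Set

/-- The function `t ↦ exp (-(t² + b²/t²))` is integrable on `(0, ∞)`. -/
lemma integrableOn_exp_neg_sq_add_div_sq (b : ℝ) :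
    IntegrableOn (fun t : ℝ => Real.exp (-(t ^ 2 + b ^ 2 / t ^ 2))) (Ioi 0) := by
  have hgauss : IntegrableOn (fun t : ℝ => Real.exp (-1 * t ^ 2)) (Ioi 0) :=
    (integrable_exp_neg_mul_sq one_pos).integrableOn
  refine Integrable.mono' hgauss (by fun_prop) (ae_of_all _ fun t => ?_)
  rw [Real.norm_eq_abs, Real.abs_exp, Real.exp_le_exp]
  have : 0 ≤ b ^ 2 / t ^ 2 := by positivity
  linarith

/-- Subordination identity: `∫ exp (-(t² + b²/t²)) dt` over `(0, ∞)` is a multiple of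
`exp (-2b)`. -/
lemma integral_exp_neg_sq_add_div_sq {b : ℝ} (hb : 0 ≤ b) :
    ∫ t in Ioi (0 : ℝ), Real.exp (-(t ^ 2 + b ^ 2 / t ^ 2)) =
      √Real.pi / 2 * Real.exp (-(2 * b)) := by
  rcases hb.eq_or_lt with rfl | hb
  · simpa using integral_gaussian_Ioi 1
  set Φ : ℝ → ℝ := fun x => ∫ y in (0 : ℝ)..x, Real.exp (-1 * y ^ 2) with hΦ
  have hint : Integrable (fun t : ℝ => Real.exp (-1 * t ^ 2)) :=
    integrable_exp_neg_mul_sq one_pos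
  have hderivΦ (x : ℝ) : HasDerivAt Φ (Real.exp (-1 * x ^ 2)) x :=
    (show Continuous fun y : ℝ => Real.exp (-1 * y ^ 2) by fun_prop).integral_hasStrictDerivAt
      0 x |>.hasDerivAt
  have htop : Tendsto Φ atTop (𝓝 (√Real.pi / 2)) := by
    have h := intervalIntegral_tendsto_integral_Ioi 0 hint.integrableOn tendsto_id
    rwa [integral_gaussian_Ioi, div_one] at h
  have hodd (x : ℝ) : Φ (-x) = -Φ x := by
    have h := intervalIntegral.integral_comp_neg (a := 0) (b := x)
      (fun y : ℝ => Real.exp (-1 * y ^ 2))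
    simp only [neg_sq, neg_zero] at h
    simp only [hΦ]
    rw [h, intervalIntegral.integral_symm]
  have hbot : Tendsto Φ atBot (𝓝 (-(√Real.pi / 2))) := by
    refine (htop.comp tendsto_neg_atBot_atTop).neg.congr fun x => ?_
    simp [hodd]
  set F : ℝ → ℝ := fun t =>
    (Real.exp (2 * b) * Φ (t + b / t) + Real.exp (-(2 * b)) * Φ (t - b / t)) / 2 with hF
  have hderiv : ∀ t ∈ Ioi (0 : ℝ), HasDerivAt F (Real.exp (-(t ^ 2 + b ^ 2 / t ^ 2))) t := by
    intro t ht
    have ht0 : t ≠ 0 := (mem_Ioi.1 ht).ne'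
    have hdiv : HasDerivAt (fun t : ℝ => b / t) (-b / t ^ 2) t := by
      simpa [div_eq_mul_inv] using (hasDerivAt_inv ht0).const_mul b
    have hplus := (hderivΦ (t + b / t)).comp t ((hasDerivAt_id t).add hdiv)
    have hminus := (hderivΦ (t - b / t)).comp t ((hasDerivAt_id t).sub hdiv)
    refine (((hplus.const_mul (Real.exp (2 * b))).add
      (hminus.const_mul (Real.exp (-(2 * b))))).div_const 2).congr_deriv ?_
    rw [← mul_assoc, ← mul_assoc, ← Real.exp_add, ← Real.exp_add]
    have e1 : 2 * b + -1 * (t + b / t) ^ 2 = -(t ^ 2 + b ^ 2 / t ^ 2) := by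
      field_simp; ring
    have e2 : -(2 * b) + -1 * (t - b / t) ^ 2 = -(t ^ 2 + b ^ 2 / t ^ 2) := by
      field_simp; ring
    rw [e1, e2]
    ring
  have hdiv_top : Tendsto (fun t : ℝ => b / t) atTop (𝓝 0) :=
    tendsto_const_nhds.div_atTop tendsto_id
  have hdiv_zero : Tendsto (fun t : ℝ => b / t) (𝓝[>] 0) atTop := by
    simpa [div_eq_mul_inv] using tendsto_inv_nhdsGT_zero.const_mul_atTop hb
  have hid_zero : Tendsto (fun t : ℝ => t) (𝓝[>] 0) (𝓝 0) := nhdsWithin_le_nhds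
  have hF_top : Tendsto F atTop (𝓝 ((Real.exp (2 * b) * (√Real.pi / 2) +
      Real.exp (-(2 * b)) * (√Real.pi / 2)) / 2)) := by
    refine Tendsto.div_const (Tendsto.add (Tendsto.const_mul _ (htop.comp ?_))
      (Tendsto.const_mul _ (htop.comp ?_))) 2
    · exact tendsto_id.atTop_add hdiv_top
    · simpa [sub_eq_add_neg] using tendsto_id.atTop_add hdiv_top.neg
  have hF_zero : Tendsto F (𝓝[>] 0) (𝓝 ((Real.exp (2 * b) * (√Real.pi / 2) +
      Real.exp (-(2 * b)) * (-(√Real.pi / 2))) / 2)) := by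
    refine Tendsto.div_const (Tendsto.add (Tendsto.const_mul _ (htop.comp ?_))
      (Tendsto.const_mul _ (hbot.comp ?_))) 2
    · exact hid_zero.add_atTop hdiv_zero
    · simpa [sub_eq_add_neg] using hid_zero.add_atBot (tendsto_neg_atTop_atBot.comp hdiv_zero)
  have key := integral_Ioi_deriv_mul_eq_sub (v := fun _ => (1 : ℝ)) (v' := fun _ => (0 : ℝ))
    (a := 0) hderiv (fun x _ => hasDerivAt_const x 1)
    (by simpa [Pi.mul_def, Pi.add_def] using integrableOn_exp_neg_sq_add_div_sq b)
    (by simpa [Pi.mul_def] using hF_zero) (by simpa [Pi.mul_def] using hF_top)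
  simp only [mul_one, mul_zero, add_zero] at key
  rw [key]
  ring

open ProbabilityTheory in
/-- The Gaussian kernel on a Euclidean space is positive semidefinite. -/
lemma sum_mul_exp_neg_norm_sq_nonneg {E ι : Type*} [NormedAddCommGroup E] [InnerProductSpace ℝ E]
    [FiniteDimensional ℝ E] [Fintype ι] (c : ι → ℝ) (x : ι → E) :
    0 ≤ ∑ i, ∑ j, c i * c j * Real.exp (-‖x i - x j‖ ^ 2 / 2) := by
  borelize E
  have hcos_int (t : E) : Integrable (fun y : E => Real.cos (inner ℝ y t)) (stdGaussian E) :=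
    Integrable.of_bound (by fun_prop) 1 (ae_of_all _ fun y => by
      simpa using Real.abs_cos_le_one _)
  have hcos (t : E) : Real.exp (-‖t‖ ^ 2 / 2) = ∫ y, Real.cos (inner ℝ y t) ∂stdGaussian E := by
    have hexp_int : Integrable (fun y : E => Complex.exp (inner ℝ y t * Complex.I))
        (stdGaussian E) :=
      Integrable.of_bound (by fun_prop) 1 (ae_of_all _ fun y => by
        simp [Complex.norm_exp_ofReal_mul_I])
    have h := congrArg Complex.re (charFun_stdGaussian t)
    rw [charFun_apply] at h
    have hre := integral_re hexp_int
    simp only [RCLike.re_eq_complex_re, Complex.exp_ofReal_mul_I_re] at hre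
    rw [hre, h]
    norm_cast
  simp_rw [hcos, ← integral_const_mul]
  simp_rw [← integral_finsetSum Finset.univ fun j _ => (hcos_int (x _ - x j)).const_mul _]
  rw [← integral_finsetSum Finset.univ fun i _ =>
    integrable_finsetSum _ fun j _ => (hcos_int (x i - x j)).const_mul _]
  refine integral_nonneg fun y => ?_
  have hsq : ∑ i, ∑ j, c i * c j * Real.cos (inner ℝ y (x i - x j)) =
      (∑ i, c i * Real.cos (inner ℝ y (x i))) ^ 2 +
        (∑ i, c i * Real.sin (inner ℝ y (x i))) ^ 2 := by
    simp_rw [sq, Finset.sum_mul_sum, ← Finset.sum_add_distrib, inner_sub_right, Real.cos_sub]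
    exact Finset.sum_congr rfl fun i _ => Finset.sum_congr rfl fun j _ => by ring
  simp only [Pi.zero_apply, hsq]
  positivity

/-- As the bandwidth tends to zero, the quadratic form of the Gaussian kernel at distinct points
tends to the sum of squares. -/
lemma tendsto_sum_mul_exp_neg_norm_sq {E ι : Type*} [NormedAddCommGroup E] [Fintype ι]
    (c : ι → ℝ) {x : ι → E} (hx : Function.Injective x) :
    Tendsto (fun t : ℝ => ∑ i, ∑ j, c i * c j * Real.exp (-((‖x i - x j‖ / 2) ^ 2 / t ^ 2)))
      (𝓝[>] 0) (𝓝 (∑ i, c i ^ 2)) := by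
  classical
  have hlim : ∑ i, c i ^ 2 = ∑ i, ∑ j, c i * c j * if i = j then (1 : ℝ) else 0 := by
    simp [sq]
  rw [hlim]
  refine tendsto_finsetSum _ fun i _ => tendsto_finsetSum _ fun j _ => Tendsto.const_mul _ ?_
  split_ifs with hij
  · simp [hij]
  · have hpos : 0 < (‖x i - x j‖ / 2) ^ 2 := by
      have := norm_pos_iff.2 (sub_ne_zero.2 (hx.ne hij))
      positivity
    refine Real.tendsto_exp_neg_atTop_nhds_zero.comp ?_
    have hinv : Tendsto (fun t : ℝ => (t⁻¹) ^ 2) (𝓝[>] 0) atTop :=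
      (tendsto_pow_atTop two_ne_zero).comp tendsto_inv_nhdsGT_zero
    simpa [div_eq_mul_inv] using hinv.const_mul_atTop hpos

/-- The Laplace kernel on a Euclidean space is strictly positive definite. -/
lemma sum_mul_exp_neg_norm_pos {E ι : Type*} [NormedAddCommGroup E] [InnerProductSpace ℝ E]
    [FiniteDimensional ℝ E] [Fintype ι] {c : ι → ℝ} (hc : c ≠ 0) {x : ι → E}
    (hx : Function.Injective x) :
    0 < ∑ i, ∑ j, c i * c j * Real.exp (-‖x i - x j‖) := by
  set q : ℝ → ℝ := fun t =>
    ∑ i, ∑ j, c i * c j * Real.exp (-((‖x i - x j‖ / 2) ^ 2 / t ^ 2)) with hq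
  set f : ℝ → ℝ := fun t =>
    ∑ i, ∑ j, c i * c j * Real.exp (-(t ^ 2 + (‖x i - x j‖ / 2) ^ 2 / t ^ 2)) with hf
  have hfq (t : ℝ) : f t = Real.exp (-t ^ 2) * q t := by
    simp only [hf, hq, Finset.mul_sum, neg_add, Real.exp_add]
    exact Finset.sum_congr rfl fun i _ => Finset.sum_congr rfl fun j _ => by ring
  have hint (i j : ι) :=
    (integrableOn_exp_neg_sq_add_div_sq (‖x i - x j‖ / 2)).const_mul (c i * c j)
  have hf_int : IntegrableOn f (Ioi 0) :=
    integrable_finsetSum _ fun i _ => integrable_finsetSum _ fun j _ => hint i j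
  have hf_integral : ∫ t in Ioi (0 : ℝ), f t =
      √Real.pi / 2 * ∑ i, ∑ j, c i * c j * Real.exp (-‖x i - x j‖) := by
    simp only [hf]
    rw [integral_finsetSum _ fun i _ => integrable_finsetSum _ fun j _ => hint i j,
      Finset.mul_sum]
    refine Finset.sum_congr rfl fun i _ => ?_
    rw [integral_finsetSum _ fun j _ => hint i j, Finset.mul_sum]
    refine Finset.sum_congr rfl fun j _ => ?_
    rw [integral_const_mul, integral_exp_neg_sq_add_div_sq (by positivity),
      mul_div_cancel₀ _ two_ne_zero]
    ring
  have hq_nonneg (t : ℝ) : 0 ≤ q t := by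
    refine (sum_mul_exp_neg_norm_sq_nonneg c fun i => (√2 * t)⁻¹ • x i).trans_eq ?_
    refine Finset.sum_congr rfl fun i _ => Finset.sum_congr rfl fun j _ => ?_
    rw [← smul_sub, norm_smul, mul_pow, Real.norm_eq_abs, sq_abs, inv_pow, mul_pow,
      Real.sq_sqrt zero_le_two, mul_inv]
    ring_nf
  have hq_pos : ∀ᶠ t in 𝓝[>] (0 : ℝ), 0 < q t := by
    refine (tendsto_sum_mul_exp_neg_norm_sq c hx).eventually_const_lt ?_
    obtain ⟨i, hi⟩ := Function.ne_iff.1 hc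
    exact Finset.sum_pos' (fun j _ => sq_nonneg _) ⟨i, Finset.mem_univ i, sq_pos_iff.2 hi⟩
  obtain ⟨ε, hε, hε_pos⟩ := mem_nhdsGT_iff_exists_Ioo_subset.1 hq_pos
  have hpos : 0 < ∫ t in Ioi (0 : ℝ), f t := by
    rw [setIntegral_pos_iff_support_of_nonneg_ae
      (ae_of_all _ fun t => by rw [hfq]; exact mul_nonneg (Real.exp_nonneg _) (hq_nonneg t)) hf_int]
    refine lt_of_lt_of_le ?_ (measure_mono (s := Ioo 0 ε) fun t ht => ⟨?_, ht.1⟩)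
    · simpa using hε
    · rw [Function.mem_support, hfq]
      exact (mul_pos (Real.exp_pos _) (hε_pos ht)).ne'
  rw [hf_integral] at hpos
  exact pos_of_mul_pos_right hpos (by positivity)

/-- For every `m ≥ 1` and every choice of `m` pairwise distinct points in `ℝ^d`,
the Laplace kernel matrix `[exp (-‖x i - x j‖)]` is symmetric positive definite. -/
theorem laplace_kernel_matrix_posDef (d m : ℕ) (hm : 1 ≤ m)
    (x : Fin m → EuclideanSpace ℝ (Fin d)) (hx : Function.Injective x) :
    (Matrix.of fun i j : Fin m => Real.exp (-‖x i - x j‖)).PosDef ∧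
    ∀ c : Fin m → ℝ, c ≠ 0 →
      0 < ∑ i : Fin m, ∑ j : Fin m, c i * c j * Real.exp (-‖x i - x j‖) := by
  refine ⟨.of_dotProduct_mulVec_pos ?_ fun c hc => ?_, fun c hc => sum_mul_exp_neg_norm_pos hc hx⟩
  · ext i j
    simp [norm_sub_rev]
  · refine (sum_mul_exp_neg_norm_pos hc hx).trans_eq ?_
    simp only [dotProduct, Matrix.mulVec, Matrix.of_apply, Finset.mul_sum, Pi.star_apply,
      star_trivial]
    exact Finset.sum_congr rfl fun i _ => Finset.sum_congr rfl fun j _ => by ring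
end

section
/- For every m ≥ 1 and every choice of m pairwise distinct points x¹, …, x^m in ℝ^d, the Gauss kernel matrix M = [exp(−‖x^i − x^j‖²)]_{1≤i,j≤m} is symmetric positive definite; that is, for every nonzero vector c ∈ ℝ^m one has ∑_{i,j} c_i c_j exp(−‖x^i − x^j‖²) > 0. -/
/-- The exponentials `z ↦ exp ⟪y i, z⟫` at distinct points `y i` are linearly independent. -/
theorem linearIndependent_exp_inner {ι E : Type*} [NormedAddCommGroup E] [InnerProductSpace ℝ E]
    {y : ι → E} (hy : Function.Injective y) :
    LinearIndependent ℝ fun i (z : E) => Real.exp (inner ℝ (y i) z) := by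
  let χ : ι → Multiplicative E →* ℝ := fun i =>
    { toFun := fun z => Real.exp (inner ℝ (y i) z.toAdd)
      map_one' := by simp
      map_mul' := fun z w => by simp [inner_add_right, Real.exp_add] }
  have hχ : Function.Injective χ := by
    intro i j h
    apply hy
    refine ext_inner_right ℝ fun z => ?_
    simpa [χ] using DFunLike.congr_fun h (Multiplicative.ofAdd z)
  exact (linearIndependent_monoidHom (Multiplicative E) ℝ).comp χ hχ

/-- Completing the square: a product of Gaussians is the Gauss kernel of the centres times a
Gaussian around their midpoint. -/
theorem exp_norm_sub_mul_exp_norm_sub {E : Type*} [NormedAddCommGroup E] [InnerProductSpace ℝ E]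
    (x y z : E) :
    Real.exp (-2 * ‖z - x‖ ^ 2) * Real.exp (-2 * ‖z - y‖ ^ 2) =
      Real.exp (-‖x - y‖ ^ 2) * Real.exp (-4 * ‖z - (2⁻¹ : ℝ) • (x + y)‖ ^ 2) := by
  rw [← Real.exp_add, ← Real.exp_add]
  congr 1
  simp only [norm_sub_sq_real, norm_smul, mul_pow, norm_add_sq_real, inner_smul_right,
    inner_add_right]
  norm_num
  ring

section GaussKernel

variable {E : Type*} [NormedAddCommGroup E] [InnerProductSpace ℝ E]

theorem exists_sum_mul_exp_norm_sub_ne_zero {ι : Type*} [Fintype ι] {x : ι → E}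
    (hx : Function.Injective x) {c : ι → ℝ} (hc : c ≠ 0) :
    ∃ z, ∑ i, c i * Real.exp (-2 * ‖z - x i‖ ^ 2) ≠ 0 := by
  by_contra! h
  have hli := linearIndependent_exp_inner (y := fun i => (4 : ℝ) • x i)
    fun i j hij => hx (smul_right_injective E (by norm_num : (4 : ℝ) ≠ 0) hij)
  have hzero := Fintype.linearIndependent_iff.1 hli (fun i => c i * Real.exp (-2 * ‖x i‖ ^ 2)) <| by
    ext z
    have hz : ∑ i, c i * Real.exp (-2 * ‖x i‖ ^ 2) * Real.exp (inner ℝ ((4 : ℝ) • x i) z) =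
        Real.exp (2 * ‖z‖ ^ 2) * ∑ i, c i * Real.exp (-2 * ‖z - x i‖ ^ 2) := by
      rw [Finset.mul_sum]
      refine Finset.sum_congr rfl fun i _ => ?_
      rw [mul_left_comm, mul_assoc, ← Real.exp_add, ← Real.exp_add, norm_sub_sq_real,
        real_inner_smul_left, real_inner_comm]
      ring_nf
    rw [h z, mul_zero] at hz
    simpa using hz
  exact hc <| funext fun i => (mul_eq_zero.1 (hzero i)).resolve_right (Real.exp_ne_zero _)

variable [FiniteDimensional ℝ E] [MeasurableSpace E] [BorelSpace E]

open MeasureTheory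

theorem integrable_exp_neg_four_mul_norm_sq :
    Integrable fun z : E => Real.exp (-4 * ‖z‖ ^ 2) := by
  have h := (GaussianFourier.integrable_cexp_neg_mul_sq_norm_add (V := E) (b := 4) (by norm_num)
    0 0).norm
  refine h.congr (ae_of_all _ fun z => ?_)
  simp only [Complex.norm_exp]
  norm_cast
  simp

theorem integrable_exp_norm_sub_mul (x y : E) :
    Integrable fun z : E => Real.exp (-2 * ‖z - x‖ ^ 2) * Real.exp (-2 * ‖z - y‖ ^ 2) := by
  simp only [exp_norm_sub_mul_exp_norm_sub]
  exact (integrable_exp_neg_four_mul_norm_sq.comp_sub_right _).const_mul _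

theorem integral_exp_norm_sub_mul (x y : E) :
    ∫ z : E, Real.exp (-2 * ‖z - x‖ ^ 2) * Real.exp (-2 * ‖z - y‖ ^ 2) =
      Real.exp (-‖x - y‖ ^ 2) * ∫ z : E, Real.exp (-4 * ‖z‖ ^ 2) := by
  simp only [exp_norm_sub_mul_exp_norm_sub, integral_const_mul]
  rw [integral_sub_right_eq_self fun z : E => Real.exp (-4 * ‖z‖ ^ 2)]

theorem sum_mul_exp_neg_norm_sub_sq_pos {ι : Type*} [Fintype ι] {x : ι → E}
    (hx : Function.Injective x) {c : ι → ℝ} (hc : c ≠ 0) :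
    0 < ∑ i, ∑ j, c i * c j * Real.exp (-‖x i - x j‖ ^ 2) := by
  have hsq : ∀ z : E, (∑ i, c i * Real.exp (-2 * ‖z - x i‖ ^ 2)) ^ 2 =
      ∑ i, ∑ j, c i * c j *
        (Real.exp (-2 * ‖z - x i‖ ^ 2) * Real.exp (-2 * ‖z - x j‖ ^ 2)) := fun z => by
    simp only [sq (∑ i, _), Finset.sum_mul_sum, mul_mul_mul_comm]
  have hint : ∀ i j, Integrable fun z : E => c i * c j *
      (Real.exp (-2 * ‖z - x i‖ ^ 2) * Real.exp (-2 * ‖z - x j‖ ^ 2)) :=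
    fun i j => (integrable_exp_norm_sub_mul _ _).const_mul _
  obtain ⟨z, hz⟩ := exists_sum_mul_exp_norm_sub_ne_zero hx hc
  have hpos : 0 < ∫ z : E, (∑ i, c i * Real.exp (-2 * ‖z - x i‖ ^ 2)) ^ 2 := by
    refine integral_pos_of_integrable_nonneg_nonzero (x := z) (by fun_prop) ?_
      (fun z => sq_nonneg _) (pow_ne_zero 2 hz)
    simp only [hsq]
    exact integrable_finsetSum _ fun i _ => integrable_finsetSum _ fun j _ => hint i j
  have heq : ∫ z : E, (∑ i, c i * Real.exp (-2 * ‖z - x i‖ ^ 2)) ^ 2 =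
      (∑ i, ∑ j, c i * c j * Real.exp (-‖x i - x j‖ ^ 2)) *
        ∫ z : E, Real.exp (-4 * ‖z‖ ^ 2) := by
    simp only [hsq]
    rw [integral_finsetSum _ fun i _ => integrable_finsetSum _ fun j _ => hint i j]
    simp only [Finset.sum_mul]
    refine Finset.sum_congr rfl fun i _ => ?_
    rw [integral_finsetSum _ fun j _ => hint i j]
    simp only [integral_const_mul, integral_exp_norm_sub_mul, mul_assoc]
  rw [heq] at hpos
  exact pos_of_mul_pos_left hpos (integral_nonneg fun z => (Real.exp_pos _).le)

end GaussKernel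

/-- For every `m ≥ 1` and every choice of `m` pairwise distinct points in `ℝ^d`,
the Gauss kernel matrix `[exp (-‖x i - x j‖^2)]` is symmetric positive definite. -/
theorem gauss_kernel_matrix_posDef (d m : ℕ) (hm : 1 ≤ m)
    (x : Fin m → EuclideanSpace ℝ (Fin d)) (hx : Function.Injective x) :
    (Matrix.of fun i j : Fin m => Real.exp (-‖x i - x j‖ ^ 2)).PosDef ∧
    ∀ c : Fin m → ℝ, c ≠ 0 →
      0 < ∑ i : Fin m, ∑ j : Fin m, c i * c j * Real.exp (-‖x i - x j‖ ^ 2) := by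
  have hpos : ∀ c : Fin m → ℝ, c ≠ 0 →
      0 < ∑ i : Fin m, ∑ j : Fin m, c i * c j * Real.exp (-‖x i - x j‖ ^ 2) :=
    fun c hc => sum_mul_exp_neg_norm_sub_sq_pos hx hc
  refine ⟨.of_dotProduct_mulVec_pos ?_ fun c hc => ?_, hpos⟩
  · exact Matrix.IsHermitian.ext fun i j => by simp [norm_sub_rev]
  · simpa [dotProduct, Matrix.mulVec, Finset.mul_sum, mul_assoc, mul_left_comm, mul_comm]
      using hpos c hc
end

section
/- Let x¹, …, x^m be pairwise distinct points in ℝ^d, let K be either the Laplace kernel K(x) = exp(−‖x‖) or the Gauss kernel K(x) = exp(−‖x‖²), let M = [K(x^i − x^j)]_{1≤i,j≤m}, and let α ≥ 0. Then the matrix mα·I + M is positive definite, hence invertible; in particular, for every b ∈ ℝ^m the linear system (mα·I + M)Λ = b has a unique solution Λ ∈ ℝ^m. -/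
open Matrix MeasureTheory Set

open scoped InnerProductSpace

section GaussKernel

variable {ι E : Type*} [Fintype ι] [NormedAddCommGroup E] [InnerProductSpace ℝ E]

theorem posSemidef_inner_pow (x : ι → E) (k : ℕ) :
    (Matrix.of fun i j => ⟪x i, x j⟫_ℝ ^ k).PosSemidef := by
  induction k with
  | zero =>
    simpa [Matrix.vecMulVec, Pi.star_def] using!
      Matrix.posSemidef_vecMulVec_self_star (R := ℝ) (fun _ : ι => (1 : ℝ))
  | succ k ih => exact ih.hadamard (Matrix.posSemidef_gram ℝ x)

/-- For injective `x`, a vector annihilated by all the entrywise powers of the Gram matrix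
of `x` vanishes. -/
theorem eq_zero_of_sum_inner_pow_mul_eq_zero {x : ι → E} (hx : Function.Injective x) {w : ι → ℝ}
    (h : ∀ (k : ℕ) (i : ι), ∑ j, ⟪x i, x j⟫_ℝ ^ k * w j = 0) : w = 0 := by
  classical
  by_contra hw
  obtain ⟨l, hl⟩ := Function.ne_iff.mp hw
  obtain ⟨i, hi, hmax⟩ := (Finset.univ.filter fun j => w j ≠ 0).exists_max_image (fun j => ‖x j‖)
    ⟨l, by simpa using hl⟩
  rw [Finset.mem_filter_univ] at hi
  have hpoly (p : Polynomial ℝ) : ∑ j, p.eval ⟪x i, x j⟫_ℝ * w j = 0 := by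
    simp_rw [Polynomial.eval_eq_sum_range, Finset.sum_mul]
    rw [Finset.sum_comm]
    refine Finset.sum_eq_zero fun k _ => ?_
    simp_rw [mul_assoc, ← Finset.mul_sum, h k i, mul_zero]
  have hne (j : ι) (hj : w j ≠ 0) (hji : j ≠ i) : ⟪x i, x j⟫_ℝ ≠ ⟪x i, x i⟫_ℝ := by
    intro heq
    have h1 : ‖x j‖ ≤ ‖x i‖ := hmax j (by simpa using hj)
    have h2 : 0 < ‖x i - x j‖ := norm_pos_iff.mpr (sub_ne_zero.mpr fun e => hji (hx e.symm))
    have h3 := norm_sub_sq_real (x i) (x j)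
    rw [heq, real_inner_self_eq_norm_sq] at h3
    nlinarith [norm_nonneg (x j)]
  have hp := hpoly (∏ j ∈ Finset.univ.filter fun j => w j ≠ 0 ∧ j ≠ i,
    (Polynomial.X - Polynomial.C ⟪x i, x j⟫_ℝ))
  simp only [Polynomial.eval_prod, Polynomial.eval_sub, Polynomial.eval_X,
    Polynomial.eval_C] at hp
  rw [Finset.sum_eq_single i] at hp
  · refine (mul_ne_zero (Finset.prod_ne_zero_iff.mpr fun j hj => ?_) hi) hp
    rw [Finset.mem_filter_univ] at hj
    exact sub_ne_zero.mpr (hne j hj.1 hj.2).symm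
  · intro j _ hji
    by_cases hj : w j = 0
    · rw [hj, mul_zero]
    · rw [Finset.prod_eq_zero (i := j) (by simp [hj, hji]) (sub_self _), zero_mul]
  · simp

theorem sum_sum_mul_exp_inner_pos {x : ι → E} (hx : Function.Injective x) {c : ℝ} (hc : 0 < c)
    {w : ι → ℝ} (hw : w ≠ 0) :
    0 < ∑ i, ∑ j, w i * w j * Real.exp (c * ⟪x i, x j⟫_ℝ) := by
  set P : ℕ → Matrix ι ι ℝ := fun k => Matrix.of fun i j => ⟪x i, x j⟫_ℝ ^ k with hP
  have hsum : HasSum (fun k : ℕ => c ^ k / k.factorial * (star w ⬝ᵥ (P k *ᵥ w)))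
      (∑ i, ∑ j, w i * w j * Real.exp (c * ⟪x i, x j⟫_ℝ)) := by
    have : HasSum (fun k : ℕ => ∑ i, ∑ j, w i * w j * ((c * ⟪x i, x j⟫_ℝ) ^ k / k.factorial))
        (∑ i, ∑ j, w i * w j * Real.exp (c * ⟪x i, x j⟫_ℝ)) := by
      refine hasSum_sum fun i _ => hasSum_sum fun j _ => HasSum.mul_left _ ?_
      rw [Real.exp_eq_exp_ℝ]
      exact NormedSpace.expSeries_div_hasSum_exp _
    refine this.congr_fun fun k => ?_
    simp only [dotProduct, mulVec, hP, Matrix.of_apply, Finset.mul_sum, Pi.star_apply, star_trivial]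
    refine Finset.sum_congr rfl fun i _ => Finset.sum_congr rfl fun j _ => ?_
    ring
  have hnonneg (k : ℕ) : 0 ≤ c ^ k / k.factorial * (star w ⬝ᵥ (P k *ᵥ w)) :=
    mul_nonneg (by positivity) ((posSemidef_inner_pow x k).dotProduct_mulVec_nonneg w)
  obtain ⟨k, hk⟩ : ∃ k, star w ⬝ᵥ (P k *ᵥ w) ≠ 0 := by
    by_contra! hall
    refine hw (eq_zero_of_sum_inner_pow_mul_eq_zero hx fun k i => ?_)
    exact congrFun (((posSemidef_inner_pow x k).dotProduct_mulVec_zero_iff w).mp (hall k)) i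
  rw [← hsum.tsum_eq]
  refine hsum.summable.tsum_pos hnonneg k ((hnonneg k).lt_of_ne' (mul_ne_zero ?_ hk))
  positivity

theorem sum_sum_mul_exp_neg_mul_norm_sub_sq_pos {x : ι → E} (hx : Function.Injective x) {c : ℝ}
    (hc : 0 < c) {w : ι → ℝ} (hw : w ≠ 0) :
    0 < ∑ i, ∑ j, w i * w j * Real.exp (-(c * ‖x i - x j‖ ^ 2)) := by
  have hu : (fun i => w i * Real.exp (-(c * ‖x i‖ ^ 2))) ≠ 0 := fun h =>
    hw (funext fun i => (mul_eq_zero.mp (congrFun h i)).resolve_right (Real.exp_ne_zero _))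
  refine (sum_sum_mul_exp_inner_pos hx (mul_pos two_pos hc) hu).trans_eq
    (Finset.sum_congr rfl fun i _ => Finset.sum_congr rfl fun j _ => ?_)
  rw [norm_sub_sq_real, show -(c * (‖x i‖ ^ 2 - 2 * ⟪x i, x j⟫_ℝ + ‖x j‖ ^ 2)) =
    -(c * ‖x i‖ ^ 2) + -(c * ‖x j‖ ^ 2) + 2 * c * ⟪x i, x j⟫_ℝ by ring, Real.exp_add, Real.exp_add]
  ring

end GaussKernel

section GaussMixture

theorem integrableOn_exp_neg_sq_sub_div_sq (a : ℝ) :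
    IntegrableOn (fun s : ℝ => Real.exp (-s ^ 2 - a ^ 2 / s ^ 2)) (Ioi 0) := by
  have h : Integrable fun s : ℝ => Real.exp (-s ^ 2) := by
    simpa using integrable_exp_neg_mul_sq one_pos
  refine h.integrableOn.mono' (by fun_prop) (ae_of_all _ fun s => ?_)
  rw [Real.norm_eq_abs, Real.abs_exp, Real.exp_le_exp]
  have : 0 ≤ a ^ 2 / s ^ 2 := by positivity
  linarith

/-- The Cauchy-Schlömilch substitution for the Gaussian integral. -/
theorem integral_Ioi_exp_neg_sub_div_sq {a : ℝ} (ha : 0 < a) :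
    ∫ s in Ioi (0 : ℝ), Real.exp (-(s - a / s) ^ 2) = √Real.pi / 2 := by
  set g : ℝ → ℝ := fun s => Real.exp (-(s - a / s) ^ 2) with hg
  have hgint : IntegrableOn g (Ioi 0) := by
    refine IntegrableOn.congr_fun ((integrableOn_exp_neg_sq_sub_div_sq a).const_mul
      (Real.exp (2 * a))) (fun s hs => ?_) measurableSet_Ioi
    have hs' : s ≠ 0 := (mem_Ioi.mp hs).ne'
    simp only [hg]
    rw [← Real.exp_add]
    congr 1
    field_simp
    ring
  have hdiv (s : ℝ) (hs : s ∈ Ioi (0 : ℝ)) :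
      HasDerivWithinAt (fun s => a / s) (-(a / s ^ 2)) (Ioi 0) s := by
    have hs' : s ≠ 0 := (mem_Ioi.mp hs).ne'
    simpa [div_eq_mul_inv] using ((hasDerivAt_inv hs').const_mul a).hasDerivWithinAt
  have hanti : AntitoneOn (fun s : ℝ => a / s) (Ioi 0) := fun s hs t _ hst =>
    div_le_div_of_nonneg_left ha.le hs hst
  have himg : (fun s : ℝ => a / s) '' Ioi 0 = Ioi 0 := by
    ext t
    refine ⟨?_, fun ht => ⟨a / t, div_pos ha ht, by field_simp⟩⟩
    rintro ⟨s, hs, rfl⟩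
    exact div_pos ha hs
  have hinv : EqOn (fun s => (- -(a / s ^ 2)) • g (a / s)) (fun s => a / s ^ 2 * g s) (Ioi 0) := by
    intro s hs
    have hs' : s ≠ 0 := (mem_Ioi.mp hs).ne'
    simp only [hg, neg_neg, smul_eq_mul]
    rw [show a / (a / s) = s by field_simp]
    congr 3
    ring
  have hflip : ∫ s in Ioi 0, a / s ^ 2 * g s = ∫ s in Ioi 0, g s := by
    have h := integral_image_eq_integral_deriv_smul_of_antitoneOn measurableSet_Ioi hdiv hanti g
    rw [himg] at h
    rw [h]
    exact (setIntegral_congr_fun measurableSet_Ioi hinv).symm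
  have hflipint : IntegrableOn (fun s => a / s ^ 2 * g s) (Ioi 0) := by
    have h := integrableOn_image_iff_integrableOn_deriv_smul_of_antitoneOn
      measurableSet_Ioi hdiv hanti g
    rw [himg] at h
    exact (h.mp hgint).congr_fun hinv measurableSet_Ioi
  have hmono : MonotoneOn (fun s : ℝ => s - a / s) (Ioi 0) := fun s hs t ht hst =>
    sub_le_sub hst (hanti hs ht hst)
  have hsurj : (fun s : ℝ => s - a / s) '' Ioi 0 = univ := by
    refine eq_univ_of_forall fun v => ?_
    have hlt : |v| < √(v ^ 2 + 4 * a) := by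
      rw [← Real.sqrt_sq_eq_abs]
      exact Real.sqrt_lt_sqrt (sq_nonneg v) (by linarith)
    have hpos : 0 < (v + √(v ^ 2 + 4 * a)) / 2 := by linarith [neg_abs_le v]
    refine ⟨(v + √(v ^ 2 + 4 * a)) / 2, hpos, ?_⟩
    have hsq := Real.sq_sqrt (show 0 ≤ v ^ 2 + 4 * a by positivity)
    have hdvd : a / ((v + √(v ^ 2 + 4 * a)) / 2) = (√(v ^ 2 + 4 * a) - v) / 2 := by
      rw [div_eq_iff hpos.ne']
      linarith
    simp only [hdvd]
    ring
  have hsub := integral_image_eq_integral_deriv_smul_of_monotoneOn measurableSet_Ioi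
    (fun s hs => (hasDerivWithinAt_id s _).sub (hdiv s hs)) hmono
    (fun v => Real.exp (-v ^ 2))
  have hgauss : ∫ v : ℝ, Real.exp (-v ^ 2) = √Real.pi := by
    simpa using integral_gaussian 1
  have hsplit : ∫ s in Ioi 0, (1 - -(a / s ^ 2)) • Real.exp (-(s - a / s) ^ 2) =
      (∫ s in Ioi 0, g s) + ∫ s in Ioi 0, a / s ^ 2 * g s := by
    rw [← integral_add hgint hflipint]
    refine integral_congr_ae (ae_of_all _ fun s => ?_)
    simp only [hg, smul_eq_mul]
    ring
  have htotal : √Real.pi = (∫ s in Ioi 0, g s) + ∫ s in Ioi 0, a / s ^ 2 * g s := by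
    rw [← hsplit, ← hgauss, ← setIntegral_univ, ← hsurj]
    exact hsub
  linarith

theorem integral_Ioi_exp_neg_sq_sub_div_sq {a : ℝ} (ha : 0 ≤ a) :
    ∫ s in Ioi (0 : ℝ), Real.exp (-s ^ 2 - a ^ 2 / s ^ 2) =
      √Real.pi / 2 * Real.exp (-(2 * a)) := by
  rcases ha.eq_or_lt with rfl | ha
  · simpa using integral_gaussian_Ioi 1
  · rw [← integral_Ioi_exp_neg_sub_div_sq ha, ← integral_mul_const]
    refine setIntegral_congr_fun measurableSet_Ioi fun s hs => ?_
    have hs' : s ≠ 0 := (mem_Ioi.mp hs).ne'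
    rw [← Real.exp_add]
    congr 1
    field_simp
    ring

end GaussMixture

theorem sum_sum_mul_exp_neg_norm_sub_pos {ι E : Type*} [Fintype ι] [NormedAddCommGroup E]
    [InnerProductSpace ℝ E] {x : ι → E} (hx : Function.Injective x) {w : ι → ℝ} (hw : w ≠ 0) :
    0 < ∑ i, ∑ j, w i * w j * Real.exp (-‖x i - x j‖) := by
  have hterm (i j : ι) : IntegrableOn
      (fun s : ℝ => w i * w j * Real.exp (-s ^ 2 - (‖x i - x j‖ / 2) ^ 2 / s ^ 2)) (Ioi 0) :=
    (integrableOn_exp_neg_sq_sub_div_sq _).const_mul _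
  have hint : ∫ s in Ioi (0 : ℝ),
      ∑ i, ∑ j, w i * w j * Real.exp (-s ^ 2 - (‖x i - x j‖ / 2) ^ 2 / s ^ 2) =
      √Real.pi / 2 * ∑ i, ∑ j, w i * w j * Real.exp (-‖x i - x j‖) := by
    rw [integral_finsetSum _ fun i _ => integrable_finsetSum _ fun j _ => hterm i j,
      Finset.mul_sum]
    refine Finset.sum_congr rfl fun i _ => ?_
    rw [integral_finsetSum _ fun j _ => hterm i j, Finset.mul_sum]
    refine Finset.sum_congr rfl fun j _ => ?_
    rw [integral_const_mul, integral_Ioi_exp_neg_sq_sub_div_sq (by positivity),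
      mul_div_cancel₀ _ two_ne_zero]
    ring
  have hpos (s : ℝ) (hs : s ∈ Ioi (0 : ℝ)) :
      0 < ∑ i, ∑ j, w i * w j * Real.exp (-s ^ 2 - (‖x i - x j‖ / 2) ^ 2 / s ^ 2) := by
    have hs' : 0 < s := hs
    have h := mul_pos (Real.exp_pos (-s ^ 2)) (sum_sum_mul_exp_neg_mul_norm_sub_sq_pos hx
      (show 0 < 1 / (4 * s ^ 2) by positivity) hw)
    simp_rw [Finset.mul_sum] at h
    refine h.trans_eq (Finset.sum_congr rfl fun i _ => Finset.sum_congr rfl fun j _ => ?_)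
    rw [mul_left_comm, ← Real.exp_add]
    congr 2
    field_simp
    ring
  refine pos_of_mul_pos_right (a := √Real.pi / 2) ?_ (by positivity)
  rw [← hint, setIntegral_pos_iff_support_of_nonneg_ae
    ((ae_restrict_iff' measurableSet_Ioi).mpr (ae_of_all _ fun s hs => (hpos s hs).le))
    (integrable_finsetSum _ fun i _ => integrable_finsetSum _ fun j _ => hterm i j),
    inter_eq_self_of_subset_right fun s hs => Function.mem_support.mpr (hpos s hs).ne']
  simp

/-- For pairwise distinct points `x¹, …, x^m` in `ℝ^d`, `K` the Laplace or the Gauss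
kernel, `M = [K (x i - x j)]` and `α ≥ 0`, the matrix `mα·I + M` is positive definite,
hence for every `b` the system `(mα·I + M) Λ = b` has a unique solution. -/
theorem regularized_kernel_system_unique_solution (d m : ℕ) (hm : 1 ≤ m)
    (x : Fin m → EuclideanSpace ℝ (Fin d)) (hx : Function.Injective x)
    (K : EuclideanSpace ℝ (Fin d) → ℝ)
    (hK : (∀ y, K y = Real.exp (-‖y‖)) ∨ (∀ y, K y = Real.exp (-‖y‖ ^ 2)))
    (α : ℝ) (hα : 0 ≤ α) :
    ((((m : ℝ) * α) • (1 : Matrix (Fin m) (Fin m) ℝ) +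
        Matrix.of fun i j : Fin m => K (x i - x j)).PosDef) ∧
    ∀ b : Fin m → ℝ, ∃! Λ : Fin m → ℝ,
      (((m : ℝ) * α) • (1 : Matrix (Fin m) (Fin m) ℝ) +
        Matrix.of fun i j : Fin m => K (x i - x j)).mulVec Λ = b := by
  have hM : (Matrix.of fun i j : Fin m => K (x i - x j)).PosDef := by
    refine .of_dotProduct_mulVec_pos ?_ fun w hw => ?_
    · ext i j
      rcases hK with hK | hK <;> simp [hK, norm_sub_rev (x j) (x i)]
    · have hform : star w ⬝ᵥ ((Matrix.of fun i j : Fin m => K (x i - x j)) *ᵥ w) =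
          ∑ i, ∑ j, w i * w j * K (x i - x j) := by
        simp only [dotProduct, mulVec, Matrix.of_apply, Finset.mul_sum, Pi.star_apply, star_trivial]
        refine Finset.sum_congr rfl fun i _ => Finset.sum_congr rfl fun j _ => ?_
        ring
      rw [hform]
      rcases hK with hK | hK
      · simpa only [hK] using sum_sum_mul_exp_neg_norm_sub_pos hx hw
      · simpa only [hK, one_mul] using sum_sum_mul_exp_neg_mul_norm_sub_sq_pos hx one_pos hw
  have hA := hM.posSemidef_add (Matrix.PosSemidef.one.smul (show 0 ≤ (m : ℝ) * α by positivity))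
  exact ⟨hA, Function.Bijective.existsUnique
    ⟨Matrix.mulVec_injective_of_isUnit hA.isUnit, Matrix.mulVec_surjective_iff_isUnit.mpr hA.isUnit⟩⟩
end

section
/- Let μ be a finite signed Borel measure on ℝ^d with μ ≠ 0. Then the double integral ∫_{ℝ^d} ∫_{ℝ^d} exp(−‖x − y‖²) dμ(x) dμ(y) is strictly positive. -/
open MeasureTheory

open ProbabilityTheory Complex
open scoped RealInnerProductSpace ComplexConjugate

section PositiveDefinite

variable {E : Type*} [NormedAddCommGroup E] [InnerProductSpace ℝ E] [MeasurableSpace E]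
  [BorelSpace E] [SecondCountableTopology E]

/-- Parseval's identity for a translation-invariant kernel that is the characteristic function of
a finite measure `γ`. -/
theorem integral_integral_charFun_sub (γ μ ν : Measure E) [IsFiniteMeasure γ]
    [IsFiniteMeasure μ] [IsFiniteMeasure ν] :
    ∫ x, ∫ y, charFun γ (x - y) ∂ν ∂μ = ∫ t, charFun μ t * conj (charFun ν t) ∂γ := by
  have hint : Integrable (fun p : E × E ↦ charFun γ (p.1 - p.2)) (μ.prod ν) :=
    .of_bound (stronglyMeasurable_charFun.comp_measurable (by fun_prop)).aestronglyMeasurable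
      (γ.real Set.univ) (.of_forall fun p ↦ norm_charFun_le _)
  have hexp : Integrable (Function.uncurry fun (p : E × E) (t : E) ↦ cexp (⟪t, p.1 - p.2⟫ * I))
      ((μ.prod ν).prod γ) :=
    .of_bound (Continuous.aestronglyMeasurable (by fun_prop)) 1
      (.of_forall fun p ↦ by simp [Function.uncurry, Complex.norm_exp_ofReal_mul_I])
  rw [integral_integral hint]
  simp_rw [charFun_apply (μ := γ)]
  rw [integral_integral_swap hexp]
  congr with t
  rw [← charFun_neg, charFun_apply, charFun_apply, ← integral_prod_mul]
  congr with p
  rw [← Complex.exp_add, inner_sub_right, inner_neg_right, real_inner_comm t, real_inner_comm t]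
  push_cast
  ring_nf

/-- Bochner's positivity for differences of finite measures: the quadratic form of the kernel
`charFun γ (x - y)` on `μ - ν` is the `L²(γ)` norm squared of `charFun μ - charFun ν`. -/
theorem integral_norm_charFun_sub_sq (γ μ ν : Measure E) [IsFiniteMeasure γ]
    [IsFiniteMeasure μ] [IsFiniteMeasure ν] :
    ((∫ t, ‖charFun μ t - charFun ν t‖ ^ 2 ∂γ : ℝ) : ℂ) =
      (∫ x, ∫ y, charFun γ (x - y) ∂μ ∂μ) - (∫ x, ∫ y, charFun γ (x - y) ∂ν ∂μ)
        - (∫ x, ∫ y, charFun γ (x - y) ∂μ ∂ν) + ∫ x, ∫ y, charFun γ (x - y) ∂ν ∂ν := by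
  have hint (α β : Measure E) [IsFiniteMeasure α] [IsFiniteMeasure β] :
      Integrable (fun t ↦ charFun α t * conj (charFun β t)) γ := by
    refine .of_bound (Continuous.aestronglyMeasurable (by fun_prop))
      (α.real Set.univ * β.real Set.univ) (.of_forall fun t ↦ ?_)
    rw [norm_mul, RCLike.norm_conj]
    gcongr <;> exact norm_charFun_le _
  simp_rw [integral_integral_charFun_sub]
  rw [← integral_sub (hint _ _) (hint _ _), ← integral_sub (by fun_prop) (hint _ _),
    ← integral_add (by fun_prop) (hint _ _), ← integral_complex_ofReal]
  congr with t
  push_cast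
  rw [← Complex.mul_conj', map_sub]
  ring

theorem integral_norm_charFun_sub_sq_pos [CompleteSpace E] (γ : Measure E) [IsFiniteMeasure γ]
    [γ.IsOpenPosMeasure] {μ ν : Measure E} [IsFiniteMeasure μ] [IsFiniteMeasure ν] (h : μ ≠ ν) :
    0 < ∫ t, ‖charFun μ t - charFun ν t‖ ^ 2 ∂γ := by
  obtain ⟨t, ht⟩ := Function.ne_iff.mp (mt Measure.ext_of_charFun h)
  have hcont : Continuous fun t ↦ ‖charFun μ t - charFun ν t‖ ^ 2 := by fun_prop
  refine integral_pos_of_integrable_nonneg_nonzero (x := t) hcont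
    (.of_bound hcont.aestronglyMeasurable ((μ.real Set.univ + ν.real Set.univ) ^ 2)
      (.of_forall fun t ↦ ?_)) (fun t ↦ by positivity) (by simpa [sub_eq_zero] using ht)
  rw [norm_pow, norm_norm]
  gcongr
  refine (norm_sub_le _ _).trans ?_
  gcongr <;> exact norm_charFun_le _

end PositiveDefinite

instance isOpenPosMeasure_stdGaussian {ι : Type*} [Fintype ι] :
    (stdGaussian (EuclideanSpace ℝ ι)).IsOpenPosMeasure := by
  have : (gaussianReal 0 1).IsOpenPosMeasure :=
    (gaussianReal_absolutelyContinuous' 0 one_ne_zero).isOpenPosMeasure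
  rw [← map_pi_eq_stdGaussian]
  exact (PiLp.continuous_toLp 2 _).isOpenPosMeasure_map (WithLp.toLp_surjective 2)

/-- The Gauss kernel is the characteristic function of a finite measure charging every nonempty
open set. -/
theorem exists_charFun_eq_exp_neg_norm_sq (ι : Type*) [Fintype ι] :
    ∃ γ : Measure (EuclideanSpace ℝ ι), IsFiniteMeasure γ ∧ γ.IsOpenPosMeasure ∧
      ∀ w, charFun γ w = (Real.exp (-‖w‖ ^ 2) : ℝ) := by
  refine ⟨(stdGaussian _).map (√2 • ·), inferInstance,
    (continuous_const_smul _).isOpenPosMeasure_map (MulAction.surjective₀ (by simp)), fun w ↦ ?_⟩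
  rw [charFun_map_smul, charFun_stdGaussian, norm_smul]
  have : (√2 * ‖w‖) ^ 2 = 2 * ‖w‖ ^ 2 := by rw [mul_pow, Real.sq_sqrt zero_le_two]
  rw [Real.norm_of_nonneg (Real.sqrt_nonneg 2), ← ofReal_pow, this]
  push_cast
  ring_nf

/-- For a nonzero finite signed Borel measure `μ` on `ℝ^d`, the quadratic form
`∫∫ exp (-‖x - y‖²) dμ(x) dμ(y)` (expanded through the Jordan decomposition
`μ = μ⁺ - μ⁻`) is strictly positive: the Gauss kernel is positive definite. -/
theorem gauss_kernel_quadratic_form_pos (d : ℕ)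
    (μ : MeasureTheory.SignedMeasure (EuclideanSpace ℝ (Fin d))) (hμ : μ ≠ 0) :
    0 < (∫ x, ∫ y, Real.exp (-‖x - y‖ ^ 2) ∂μ.toJordanDecomposition.posPart
            ∂μ.toJordanDecomposition.posPart)
        - (∫ x, ∫ y, Real.exp (-‖x - y‖ ^ 2) ∂μ.toJordanDecomposition.negPart
            ∂μ.toJordanDecomposition.posPart)
        - (∫ x, ∫ y, Real.exp (-‖x - y‖ ^ 2) ∂μ.toJordanDecomposition.posPart
            ∂μ.toJordanDecomposition.negPart)
        + (∫ x, ∫ y, Real.exp (-‖x - y‖ ^ 2) ∂μ.toJordanDecomposition.negPart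
            ∂μ.toJordanDecomposition.negPart) := by
  have hne : μ.toJordanDecomposition.posPart ≠ μ.toJordanDecomposition.negPart := fun h ↦ hμ <| by
    rw [← μ.toSignedMeasure_toJordanDecomposition, JordanDecomposition.toSignedMeasure]
    simp [h]
  obtain ⟨γ, _, _, hγ⟩ := exists_charFun_eq_exp_neg_norm_sq (Fin d)
  have key := integral_norm_charFun_sub_sq γ μ.toJordanDecomposition.posPart
    μ.toJordanDecomposition.negPart
  simp_rw [hγ, integral_complex_ofReal] at key
  norm_cast at key
  exact key ▸ integral_norm_charFun_sub_sq_pos γ hne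
end

section
/- Let μ be a finite signed Borel measure on ℝ^d with μ ≠ 0. Then the double integral ∫_{ℝ^d} ∫_{ℝ^d} exp(−‖x − y‖) dμ(x) dμ(y) is strictly positive. -/
open MeasureTheory

section Subordination

open Filter Topology Real

lemma integrable_exp_mul_exp_neg_exp_sq :
    Integrable fun t : ℝ => exp t * exp (-(exp t) ^ 2) := by
  have hl : IntegrableOn (fun t : ℝ => exp t * exp (-(exp t) ^ 2)) (Set.Iic 0) := by
    refine Integrable.mono' (integrableOn_exp_Iic 0) (by fun_prop) (Eventually.of_forall fun t => ?_)
    rw [norm_of_nonneg (by positivity)]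
    have : exp (-(exp t) ^ 2) ≤ 1 := exp_le_one_iff.2 (by nlinarith [sq_nonneg (exp t)])
    nlinarith [exp_pos t]
  have hr : IntegrableOn (fun t : ℝ => exp t * exp (-(exp t) ^ 2)) (Set.Ioi 0) := by
    refine Integrable.mono' (integrableOn_exp_neg_Ioi 0) (by fun_prop)
      (Eventually.of_forall fun t => ?_)
    rw [norm_of_nonneg (by positivity), ← exp_add, exp_le_exp, ← exp_nat_mul]
    have := add_one_le_exp ((2 : ℕ) * t)
    push_cast at *
    linarith
  rw [← integrableOn_univ, ← Set.Iic_union_Ioi (a := (0 : ℝ))]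
  exact hl.union hr

lemma hasDerivAt_integral_exp_neg_sq (x : ℝ) :
    HasDerivAt (fun x : ℝ => ∫ u in (0 : ℝ)..x, exp (-u ^ 2)) (exp (-x ^ 2)) x := by
  have hc : Continuous fun u : ℝ => exp (-u ^ 2) := by fun_prop
  exact intervalIntegral.integral_hasDerivAt_right (hc.intervalIntegrable _ _)
    (hc.stronglyMeasurableAtFilter _ _) hc.continuousAt

lemma tendsto_integral_exp_neg_sq_atTop :
    Tendsto (fun x : ℝ => ∫ u in (0 : ℝ)..x, exp (-u ^ 2)) atTop (𝓝 (√π / 2)) := by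
  have h := integral_gaussian_Ioi 1
  have hi := (integrable_exp_neg_mul_sq one_pos).integrableOn (s := Set.Ioi 0)
  simp only [neg_mul, one_mul, div_one] at h hi
  rw [← h]
  exact intervalIntegral_tendsto_integral_Ioi 0 hi tendsto_id

lemma tendsto_integral_exp_neg_sq_atBot :
    Tendsto (fun x : ℝ => ∫ u in (0 : ℝ)..x, exp (-u ^ 2)) atBot (𝓝 (-(√π / 2))) := by
  refine (tendsto_integral_exp_neg_sq_atTop.comp tendsto_neg_atBot_atTop).neg.congr fun x => ?_
  have := intervalIntegral.integral_comp_neg (a := x) (b := 0) fun u : ℝ => exp (-u ^ 2)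
  simp only [neg_sq, neg_zero] at this
  rw [Function.comp_apply, ← this, intervalIntegral.integral_symm, neg_neg]

lemma integrable_exp_mul_exp_neg_exp_sq_mul (c : ℝ) :
    Integrable fun t : ℝ => exp t * exp (-(exp t) ^ 2) * exp (-(c / exp t) ^ 2) := by
  refine integrable_exp_mul_exp_neg_exp_sq.mul_bdd (c := 1) ?_ (Eventually.of_forall fun t => ?_)
  · exact (Continuous.aestronglyMeasurable
      (by fun_prop (disch := exact fun _ => (exp_pos _).ne')))
  · rw [norm_of_nonneg (by positivity)]
    exact exp_le_one_iff.2 (by nlinarith [sq_nonneg (c / exp t)])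

lemma integral_exp_mul_exp_neg_exp_sq_mul {c : ℝ} (hc : 0 ≤ c) :
    ∫ t : ℝ, exp t * exp (-(exp t) ^ 2) * exp (-(c / exp t) ^ 2) = √π / 2 * exp (-(2 * c)) := by
  have hA (t : ℝ) : HasDerivAt (fun t => exp t - c * exp (-t)) (exp t + c * exp (-t)) t := by
    convert! (hasDerivAt_exp t).sub ((hasDerivAt_neg t).exp.const_mul c) using 1
    ring
  have hB (t : ℝ) : HasDerivAt (fun t => exp t + c * exp (-t)) (exp t - c * exp (-t)) t := by
    convert! (hasDerivAt_exp t).add ((hasDerivAt_neg t).exp.const_mul c) using 1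
    ring
  have hexpA (t : ℝ) : exp (-(exp t - c * exp (-t)) ^ 2) =
      exp (2 * c) * (exp (-(exp t) ^ 2) * exp (-(c / exp t) ^ 2)) := by
    rw [← exp_add, ← exp_add, exp_neg t]
    congr 1
    field_simp
    ring
  have hexpB (t : ℝ) : exp (-(exp t + c * exp (-t)) ^ 2) =
      exp (-(2 * c)) * (exp (-(exp t) ^ 2) * exp (-(c / exp t) ^ 2)) := by
    rw [← exp_add, ← exp_add, exp_neg t]
    congr 1
    field_simp
    ring
  have hderiv (t : ℝ) := (((hasDerivAt_integral_exp_neg_sq _).comp t (hA t)).const_mul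
    (exp (-(2 * c)) / 2)).add (((hasDerivAt_integral_exp_neg_sq _).comp t (hB t)).const_mul
    (exp (2 * c) / 2))
  have hE : exp (-(2 * c)) * exp (2 * c) = 1 := by rw [← exp_add]; simp
  have hderiv' : ∀ t : ℝ, HasDerivAt _
      (exp t * exp (-(exp t) ^ 2) * exp (-(c / exp t) ^ 2)) t := fun t => by
    refine (hderiv t).congr_deriv ?_
    rw [hexpA, hexpB]
    linear_combination (exp t * exp (-(exp t) ^ 2) * exp (-(c / exp t) ^ 2)) * hE
  have hz : Tendsto (fun t : ℝ => c * exp (-t)) atTop (𝓝 0) := by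
    simpa using (tendsto_exp_neg_atTop_nhds_zero).const_mul c
  have hAtop : Tendsto (fun t => exp t - c * exp (-t)) atTop atTop := by
    simpa only [sub_eq_add_neg] using tendsto_exp_atTop.atTop_add hz.neg
  have hBtop : Tendsto (fun t => exp t + c * exp (-t)) atTop atTop :=
    tendsto_exp_atTop.atTop_add hz
  have htop := ((tendsto_integral_exp_neg_sq_atTop.comp hAtop).const_mul (exp (-(2 * c)) / 2)).add
    ((tendsto_integral_exp_neg_sq_atTop.comp hBtop).const_mul (exp (2 * c) / 2))
  rcases hc.eq_or_lt with rfl | hc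
  · have hGz := (hasDerivAt_integral_exp_neg_sq 0).continuousAt.tendsto.comp tendsto_exp_atBot
    have hbot := (hGz.const_mul (exp (-(2 * (0 : ℝ))) / 2)).add
      (hGz.const_mul (exp (2 * (0 : ℝ)) / 2))
    rw [integral_of_hasDerivAt_of_tendsto hderiv' (integrable_exp_mul_exp_neg_exp_sq_mul 0)
      (hbot.congr fun t => by simp) htop]
    simp
    ring
  · have hi : Tendsto (fun t : ℝ => c * exp (-t)) atBot atTop :=
      (tendsto_exp_atTop.comp tendsto_neg_atBot_atTop).const_mul_atTop hc
    have hAbot : Tendsto (fun t => exp t - c * exp (-t)) atBot atBot := by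
      simpa only [sub_eq_add_neg, Function.comp_def] using
        tendsto_exp_atBot.add_atBot (tendsto_neg_atTop_atBot.comp hi)
    have hBbot : Tendsto (fun t => exp t + c * exp (-t)) atBot atTop :=
      tendsto_exp_atBot.add_atTop hi
    have hbot := ((tendsto_integral_exp_neg_sq_atBot.comp hAbot).const_mul
      (exp (-(2 * c)) / 2)).add
      ((tendsto_integral_exp_neg_sq_atTop.comp hBbot).const_mul (exp (2 * c) / 2))
    rw [integral_of_hasDerivAt_of_tendsto hderiv' (integrable_exp_mul_exp_neg_exp_sq_mul c)
      hbot htop]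
    ring

end Subordination

section Mixture

variable {X S 𝕜 : Type*} [MeasurableSpace X] [MeasurableSpace S] [RCLike 𝕜]

lemma integral_sub_sub_add {ν : Measure S} {a b c d : S → 𝕜} (ha : Integrable a ν)
    (hb : Integrable b ν) (hc : Integrable c ν) (hd : Integrable d ν) :
    ∫ s, (a s - b s - c s + d s) ∂ν =
      ∫ s, a s ∂ν - ∫ s, b s ∂ν - ∫ s, c s ∂ν + ∫ s, d s ∂ν := by
  rw [integral_add (f := fun s => a s - b s - c s) ((ha.sub hb).sub hc) hd,
    integral_sub (f := fun s => a s - b s) (ha.sub hb) hc, integral_sub ha hb]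

lemma integrable_prod_mixture (P Q : Measure X) [IsFiniteMeasure P] [IsFiniteMeasure Q]
    (ν : Measure S) [SFinite ν] {h : S → 𝕜} (hh : Integrable h ν) {k : X → X → S → 𝕜}
    (hk : Measurable fun p : (X × X) × S => k p.1.1 p.1.2 p.2) (hb : ∀ x y s, ‖k x y s‖ ≤ 1) :
    Integrable (fun p : (X × X) × S => h p.2 * k p.1.1 p.1.2 p.2) ((P.prod Q).prod ν) :=
  (hh.comp_snd (P.prod Q)).mul_bdd (c := 1) hk.aestronglyMeasurable
    (Filter.Eventually.of_forall fun _ => hb _ _ _)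

lemma integral_integral_section (P Q : Measure X) [IsFiniteMeasure P] [IsFiniteMeasure Q]
    {k : X → X → S → 𝕜} (hk : Measurable fun p : (X × X) × S => k p.1.1 p.1.2 p.2)
    (hb : ∀ x y s, ‖k x y s‖ ≤ 1) (s : S) :
    ∫ p : X × X, k p.1 p.2 s ∂(P.prod Q) = ∫ x, ∫ y, k x y s ∂Q ∂P := by
  refine integral_prod _ (Integrable.of_bound ?_ 1 (Filter.Eventually.of_forall fun p => hb _ _ _))
  exact (hk.comp (measurable_id.prodMk measurable_const)).aestronglyMeasurable

lemma integral_integral_mixture (P Q : Measure X) [IsFiniteMeasure P] [IsFiniteMeasure Q]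
    (ν : Measure S) [SFinite ν] {h : S → 𝕜} (hh : Integrable h ν) {k : X → X → S → 𝕜}
    (hk : Measurable fun p : (X × X) × S => k p.1.1 p.1.2 p.2) (hb : ∀ x y s, ‖k x y s‖ ≤ 1) :
    ∫ x, ∫ y, ∫ s, h s * k x y s ∂ν ∂Q ∂P = ∫ s, h s * ∫ x, ∫ y, k x y s ∂Q ∂P ∂ν := by
  have hint := integrable_prod_mixture P Q ν hh hk hb
  have h1 := integral_prod _ hint.integral_prod_left
  rw [← h1, integral_integral_swap (f := fun (p : X × X) s => h s * k p.1 p.2 s) hint]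
  simp only [integral_const_mul, integral_integral_section P Q hk hb]

lemma integrable_mul_integral_integral (P Q : Measure X) [IsFiniteMeasure P]
    [IsFiniteMeasure Q] (ν : Measure S) [SFinite ν] {h : S → 𝕜} (hh : Integrable h ν)
    {k : X → X → S → 𝕜} (hk : Measurable fun p : (X × X) × S => k p.1.1 p.1.2 p.2)
    (hb : ∀ x y s, ‖k x y s‖ ≤ 1) :
    Integrable (fun s => h s * ∫ x, ∫ y, k x y s ∂Q ∂P) ν := by
  have := (integrable_prod_mixture P Q ν hh hk hb).integral_prod_right
  simpa only [integral_const_mul, integral_integral_section P Q hk hb] using this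

end Mixture

section Forms

variable {E : Type*} [MeasurableSpace E]

/-- The quadratic form of the real kernel `k` evaluated at the signed measure `P - N`. -/
noncomputable def kernelForm (k : E → E → ℝ) (P N : Measure E) : ℝ :=
  (∫ x, ∫ y, k x y ∂P ∂P) - (∫ x, ∫ y, k x y ∂N ∂P) - (∫ x, ∫ y, k x y ∂P ∂N)
    + ∫ x, ∫ y, k x y ∂N ∂N

open Complex ComplexConjugate

lemma norm_cexp_inner_sub {F : Type*} [NormedAddCommGroup F] [InnerProductSpace ℝ F]
    (x y v : F) : ‖cexp (I * inner ℝ (x - y) v)‖ ≤ 1 := by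
  rw [mul_comm, norm_exp_ofReal_mul_I]

variable [NormedAddCommGroup E] [InnerProductSpace ℝ E]

lemma integral_integral_cexp_inner (P Q : Measure E) (v : E) :
    ∫ x, ∫ y, cexp (I * inner ℝ (x - y) v) ∂Q ∂P = charFun P v * conj (charFun Q v) := by
  rw [← charFun_neg, charFun_apply, charFun_apply, ← integral_mul_const]
  congr 1 with x
  rw [← integral_const_mul]
  congr 1 with y
  rw [← Complex.exp_add, inner_sub_left, inner_neg_right]
  push_cast
  ring_nf

variable [FiniteDimensional ℝ E] [BorelSpace E]

lemma integrable_cexp_neg_sq {s : ℝ} (hs : 0 < s) :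
    Integrable fun v : E => cexp (-((s ^ 2 : ℝ) : ℂ) * ‖v‖ ^ 2) := by
  have hs2 : 0 < (((s ^ 2 : ℝ) : ℂ)).re := by rw [ofReal_re]; positivity
  simpa using GaussianFourier.integrable_cexp_neg_mul_sq_norm_add (V := E) hs2 0 0

lemma measurable_cexp_inner_sub :
    Measurable fun p : (E × E) × E => cexp (I * inner ℝ (p.1.1 - p.1.2) p.2) :=
  Continuous.measurable (by fun_prop)

lemma integrable_gaussian_mul_charFun (P Q : Measure E) [IsFiniteMeasure P]
    [IsFiniteMeasure Q] {s : ℝ} (hs : 0 < s) :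
    Integrable fun v : E => cexp (-((s ^ 2 : ℝ) : ℂ) * ‖v‖ ^ 2) *
      (charFun P v * conj (charFun Q v)) := by
  simpa only [integral_integral_cexp_inner] using integrable_mul_integral_integral P Q volume
    (integrable_cexp_neg_sq hs) measurable_cexp_inner_sub norm_cexp_inner_sub

lemma gaussian_integral_integral (P Q : Measure E) [IsFiniteMeasure P] [IsFiniteMeasure Q]
    {s : ℝ} (hs : 0 < s) :
    (((Real.pi / s ^ 2) ^ (Module.finrank ℝ E / 2 : ℝ) *
      ∫ x, ∫ y, Real.exp (-(‖x - y‖ / 2 / s) ^ 2) ∂Q ∂P : ℝ) : ℂ) =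
    ∫ v : E, cexp (-((s ^ 2 : ℝ) : ℂ) * ‖v‖ ^ 2) * (charFun P v * conj (charFun Q v)) := by
  have hs2 : 0 < (((s ^ 2 : ℝ) : ℂ)).re := by rw [ofReal_re]; positivity
  have hF (x y : E) : ∫ v : E, cexp (-((s ^ 2 : ℝ) : ℂ) * ‖v‖ ^ 2) * cexp (I * inner ℝ (x - y) v)
      = (((Real.pi / s ^ 2) ^ (Module.finrank ℝ E / 2 : ℝ) *
        Real.exp (-(‖x - y‖ / 2 / s) ^ 2) : ℝ) : ℂ) := by
    simp only [← Complex.exp_add]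
    rw [GaussianFourier.integral_cexp_neg_mul_sq_norm_add hs2 I (x - y), ofReal_mul,
      ofReal_cpow (by positivity), ofReal_exp]
    have : (s : ℂ) ≠ 0 := ofReal_ne_zero.2 hs.ne'
    congr 1
    · push_cast; rfl
    · push_cast
      rw [I_sq]
      congr 1
      field_simp
      norm_num
  have h := integral_integral_mixture P Q volume
    (integrable_cexp_neg_sq hs) (measurable_cexp_inner_sub (E := E)) norm_cexp_inner_sub
  simp only [integral_integral_cexp_inner, hF] at h
  rw [← h]
  simp only [integral_complex_ofReal, integral_const_mul]

lemma kernelForm_gaussian_pos (P N : Measure E) [IsFiniteMeasure P] [IsFiniteMeasure N]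
    (hPN : P ≠ N) {s : ℝ} (hs : 0 < s) :
    0 < kernelForm (fun x y => Real.exp (-(‖x - y‖ / 2 / s) ^ 2)) P N := by
  set C : ℝ := (Real.pi / s ^ 2) ^ (Module.finrank ℝ E / 2 : ℝ)
  have hCpos : 0 < C := by positivity
  set f : E → ℝ := fun v => Real.exp (-s ^ 2 * ‖v‖ ^ 2) * ‖charFun P v - charFun N v‖ ^ 2 with hf
  have hPP := integrable_gaussian_mul_charFun P P hs
  have hPN' := integrable_gaussian_mul_charFun P N hs
  have hNP := integrable_gaussian_mul_charFun N P hs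
  have hNN := integrable_gaussian_mul_charFun N N hs
  have hfeq (v : E) : (f v : ℂ) =
      cexp (-((s ^ 2 : ℝ) : ℂ) * ‖v‖ ^ 2) * (charFun P v * conj (charFun P v))
      - cexp (-((s ^ 2 : ℝ) : ℂ) * ‖v‖ ^ 2) * (charFun P v * conj (charFun N v))
      - cexp (-((s ^ 2 : ℝ) : ℂ) * ‖v‖ ^ 2) * (charFun N v * conj (charFun P v))
      + cexp (-((s ^ 2 : ℝ) : ℂ) * ‖v‖ ^ 2) * (charFun N v * conj (charFun N v)) := by
    simp only [hf]
    push_cast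
    rw [← mul_conj', map_sub]
    ring
  have hfint : Integrable f := by
    have := ((hPP.sub hPN').sub hNP).add hNN
    refine (this.re).congr (Filter.Eventually.of_forall fun v => ?_)
    have := congrArg re (hfeq v)
    rw [ofReal_re] at this
    rw [this]
    simp
  have hkey : C * kernelForm (fun x y => Real.exp (-(‖x - y‖ / 2 / s) ^ 2)) P N = ∫ v, f v := by
    rw [← ofReal_inj, ← integral_complex_ofReal]
    simp only [hfeq]
    rw [integral_sub_sub_add hPP hPN' hNP hNN, ← gaussian_integral_integral _ _ hs,
      ← gaussian_integral_integral _ _ hs, ← gaussian_integral_integral _ _ hs,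
      ← gaussian_integral_integral _ _ hs, kernelForm]
    push_cast
    ring
  refine pos_of_mul_pos_right (hkey ▸ ?_) hCpos.le
  obtain ⟨v, hv⟩ : ∃ v, charFun P v ≠ charFun N v := by
    by_contra! h
    exact hPN (Measure.ext_of_charFun (funext h))
  refine integral_pos_of_integrable_nonneg_nonzero (x := v) ?_ hfint (fun v => by positivity) ?_
  · have := continuous_charFun (μ := P)
    have := continuous_charFun (μ := N)
    fun_prop
  · have := sub_ne_zero.2 hv
    positivity

lemma kernelForm_laplace_pos (P N : Measure E) [IsFiniteMeasure P] [IsFiniteMeasure N]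
    (hPN : P ≠ N) : 0 < kernelForm (fun x y => Real.exp (-‖x - y‖)) P N := by
  have hh := integrable_exp_mul_exp_neg_exp_sq
  have hk : Measurable fun p : (E × E) × ℝ =>
      Real.exp (-(‖p.1.1 - p.1.2‖ / 2 / Real.exp p.2) ^ 2) := by fun_prop
  have hb (x y : E) (t : ℝ) : ‖Real.exp (-(‖x - y‖ / 2 / Real.exp t) ^ 2)‖ ≤ 1 := by
    rw [Real.norm_of_nonneg (by positivity)]
    exact Real.exp_le_one_iff.2 (by nlinarith [sq_nonneg (‖x - y‖ / 2 / Real.exp t)])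
  have hmix (μ ν : Measure E) [IsFiniteMeasure μ] [IsFiniteMeasure ν] :
      √Real.pi / 2 * ∫ x, ∫ y, Real.exp (-‖x - y‖) ∂ν ∂μ =
      ∫ t, Real.exp t * Real.exp (-(Real.exp t) ^ 2) *
        ∫ x, ∫ y, Real.exp (-(‖x - y‖ / 2 / Real.exp t) ^ 2) ∂ν ∂μ := by
    rw [← integral_integral_mixture μ ν volume hh hk hb]
    simp_rw [integral_exp_mul_exp_neg_exp_sq_mul (div_nonneg (norm_nonneg _) zero_le_two),
      mul_div_cancel₀ _ (two_ne_zero' ℝ), integral_const_mul]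
  have hi (μ ν : Measure E) [IsFiniteMeasure μ] [IsFiniteMeasure ν] :=
    integrable_mul_integral_integral μ ν volume hh hk hb
  have hsplit (t : ℝ) : Real.exp t * Real.exp (-(Real.exp t) ^ 2) *
      kernelForm (fun x y => Real.exp (-(‖x - y‖ / 2 / Real.exp t) ^ 2)) P N = _ :=
    (mul_add _ _ _).trans (congrArg (· + _) ((mul_sub _ _ _).trans
      (congrArg (· - _) (mul_sub _ _ _))))
  have hkey : √Real.pi / 2 * kernelForm (fun x y => Real.exp (-‖x - y‖)) P N =
      ∫ t, Real.exp t * Real.exp (-(Real.exp t) ^ 2) *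
        kernelForm (fun x y => Real.exp (-(‖x - y‖ / 2 / Real.exp t) ^ 2)) P N := by
    simp_rw [hsplit]
    rw [integral_sub_sub_add (hi P P) (hi P N) (hi N P) (hi N N), ← hmix, ← hmix, ← hmix, ← hmix, kernelForm]
    ring
  have hpos (t : ℝ) : 0 < Real.exp t * Real.exp (-(Real.exp t) ^ 2) *
      kernelForm (fun x y => Real.exp (-(‖x - y‖ / 2 / Real.exp t) ^ 2)) P N :=
    mul_pos (by positivity) (kernelForm_gaussian_pos P N hPN (Real.exp_pos t))
  refine pos_of_mul_pos_right (hkey ▸ ?_) (by positivity : (0 : ℝ) ≤ √Real.pi / 2)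
  rw [integral_pos_iff_support_of_nonneg (fun t => (hpos t).le)]
  · rw [Set.eq_univ_of_forall (s := Function.support _) fun t => (hpos t).ne']
    simp
  · simp_rw [hsplit]
    exact (((hi P P).sub (hi P N)).sub (hi N P)).add (hi N N)

end Forms

/-- For a nonzero finite signed Borel measure `μ` on `ℝ^d`, the quadratic form
`∫∫ exp (-‖x - y‖) dμ(x) dμ(y)` (expanded through the Jordan decomposition
`μ = μ⁺ - μ⁻`) is strictly positive: the Laplace kernel is positive definite. -/
theorem laplace_kernel_quadratic_form_pos (d : ℕ)
    (μ : MeasureTheory.SignedMeasure (EuclideanSpace ℝ (Fin d))) (hμ : μ ≠ 0) :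
    0 < (∫ x, ∫ y, Real.exp (-‖x - y‖) ∂μ.toJordanDecomposition.posPart
            ∂μ.toJordanDecomposition.posPart)
        - (∫ x, ∫ y, Real.exp (-‖x - y‖) ∂μ.toJordanDecomposition.negPart
            ∂μ.toJordanDecomposition.posPart)
        - (∫ x, ∫ y, Real.exp (-‖x - y‖) ∂μ.toJordanDecomposition.posPart
            ∂μ.toJordanDecomposition.negPart)
        + (∫ x, ∫ y, Real.exp (-‖x - y‖) ∂μ.toJordanDecomposition.negPart
            ∂μ.toJordanDecomposition.negPart) := by
  refine kernelForm_laplace_pos μ.toJordanDecomposition.posPart μ.toJordanDecomposition.negPart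
    fun h => hμ ?_
  rw [← μ.toSignedMeasure_toJordanDecomposition, JordanDecomposition.toSignedMeasure]
  simp only [h, sub_self]
end

section
/- Let x¹, …, x^m be pairwise distinct points in ℝ^d forming the set 𝕏, let α ≥ 0, and let R : ℝ^d → ℝ^d be a surjective isometry (rigid transformation) with R(𝕏) = 𝕏. Let Λ ∈ ℝ^m be the unique solution of the system mα·Λ_i + ∑_{k=1}^m exp(−‖x^i − x^k‖) Λ_k = m for i = 1, …, m, and define u_𝕏(x) = (1/m) ∑_{k=1}^m Λ_k exp(−‖x − x^k‖) for x ∈ ℝ^d. Then u_𝕏(R x) = u_𝕏(x) for every x ∈ ℝ^d. -/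
/-- The density `(1 - exp (-s²)) / s²`, whose rescalings integrate to multiples of the distance. -/
noncomputable def gaussDefect (s : ℝ) : ℝ := (1 - Real.exp (-s ^ 2)) / s ^ 2

lemma gaussDefect_nonneg (s : ℝ) : 0 ≤ gaussDefect s := by
  refine div_nonneg ?_ (sq_nonneg s)
  have : Real.exp (-s ^ 2) ≤ 1 := Real.exp_le_one_iff.2 (by nlinarith [sq_nonneg s])
  linarith

lemma gaussDefect_pos {s : ℝ} (hs : s ≠ 0) : 0 < gaussDefect s := by
  have h2 : 0 < s ^ 2 := by positivity
  refine div_pos ?_ h2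
  have : Real.exp (-s ^ 2) < 1 := by
    rw [← Real.exp_zero]
    exact Real.exp_lt_exp.2 (by linarith)
  linarith

lemma gaussDefect_le (s : ℝ) : gaussDefect s ≤ 2 * (1 + s ^ 2)⁻¹ := by
  rcases eq_or_ne s 0 with rfl | hs
  · simp [gaussDefect]
  have h2 : 0 < s ^ 2 := by positivity
  rw [gaussDefect, ← div_eq_mul_inv, div_le_div_iff₀ h2 (by positivity)]
  have h3 := Real.add_one_le_exp (-s ^ 2)
  have h4 := Real.exp_pos (-s ^ 2)
  nlinarith

lemma integrable_gaussDefect : MeasureTheory.Integrable gaussDefect := by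
  refine (integrable_inv_one_add_sq.const_mul 2).mono' ?_ (.of_forall fun s => ?_)
  · unfold gaussDefect
    have : Measurable fun s : ℝ => (1 - Real.exp (-s ^ 2)) / s ^ 2 := by fun_prop
    exact this.aestronglyMeasurable
  · rw [Real.norm_of_nonneg (gaussDefect_nonneg s)]
    exact gaussDefect_le s

lemma integral_gaussDefect_pos : 0 < ∫ s, gaussDefect s := by
  rw [MeasureTheory.integral_pos_iff_support_of_nonneg gaussDefect_nonneg integrable_gaussDefect]
  refine lt_of_lt_of_le ?_ (MeasureTheory.measure_mono
    (fun s hs => (gaussDefect_pos (ne_of_gt hs)).ne' : Set.Ioi (0 : ℝ) ⊆ _))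
  simp

lemma one_sub_exp_div_sq (r s : ℝ) :
    (1 - Real.exp (-(s * r) ^ 2)) / s ^ 2 = r ^ 2 * gaussDefect (r * s) := by
  rcases eq_or_ne r 0 with rfl | hr
  · simp
  rcases eq_or_ne s 0 with rfl | hs
  · simp [gaussDefect]
  rw [gaussDefect, mul_comm s r]
  field_simp

lemma integrable_one_sub_exp_div_sq (r : ℝ) :
    MeasureTheory.Integrable fun s : ℝ => (1 - Real.exp (-(s * r) ^ 2)) / s ^ 2 := by
  simp_rw [one_sub_exp_div_sq]
  rcases eq_or_ne r 0 with rfl | hr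
  · simp
  exact (integrable_gaussDefect.comp_mul_left' hr).const_mul _

lemma integral_one_sub_exp_div_sq {r : ℝ} (hr : 0 ≤ r) :
    ∫ s : ℝ, (1 - Real.exp (-(s * r) ^ 2)) / s ^ 2 = r * ∫ s, gaussDefect s := by
  simp_rw [one_sub_exp_div_sq]
  rw [MeasureTheory.integral_const_mul, MeasureTheory.Measure.integral_comp_mul_left,
    abs_of_nonneg (inv_nonneg.2 hr), smul_eq_mul]
  rcases eq_or_ne r 0 with rfl | hr
  · simp
  field_simp

namespace Matrix

variable {ι : Type*} [Fintype ι]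

lemma star_dotProduct_mulVec_eq_sum (A : Matrix ι ι ℝ) (v : ι → ℝ) :
    star v ⬝ᵥ (A *ᵥ v) = ∑ i, ∑ j, v i * v j * A i j := by
  simp only [dotProduct, mulVec, Finset.mul_sum, star_trivial]
  exact Finset.sum_congr rfl fun i _ => Finset.sum_congr rfl fun j _ => by ring

lemma PosSemidef.sum_nonneg {A : Matrix ι ι ℝ} (hA : A.PosSemidef) (v : ι → ℝ) :
    0 ≤ ∑ i, ∑ j, v i * v j * A i j := by
  rw [← star_dotProduct_mulVec_eq_sum]
  exact hA.dotProduct_mulVec_nonneg v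

/-- Entrywise powers of positive semidefinite matrices are positive semidefinite. -/
lemma PosSemidef.map_pow {A : Matrix ι ι ℝ} (hA : A.PosSemidef) (n : ℕ) :
    (A.map (· ^ n)).PosSemidef := by
  induction n with
  | zero =>
    convert posSemidef_vecMulVec_self_star (fun _ : ι => (1 : ℝ)) using 1
    ext i j
    simp [vecMulVec]
  | succ n ih =>
    have h : A.map (· ^ (n + 1)) = (A.map (· ^ n)).hadamard A := by
      ext i j
      simp [pow_succ]
    exact h ▸ ih.hadamard hA

lemma hasSum_sum_exp (A : Matrix ι ι ℝ) (v : ι → ℝ) :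
    HasSum (fun n : ℕ => (∑ i, ∑ j, v i * v j * A i j ^ n) / n.factorial)
      (∑ i, ∑ j, v i * v j * Real.exp (A i j)) := by
  have h : HasSum (fun n : ℕ => ∑ i, ∑ j, v i * v j * (A i j ^ n / n.factorial))
      (∑ i, ∑ j, v i * v j * Real.exp (A i j)) :=
    hasSum_sum fun i _ => hasSum_sum fun j _ => by
      rw [Real.exp_eq_exp_ℝ]
      exact (NormedSpace.expSeries_div_hasSum_exp (A i j)).mul_left _
  convert h using 2 with n
  simp only [Finset.sum_div, mul_div_assoc]

lemma PosSemidef.sum_pow_div_factorial_nonneg {A : Matrix ι ι ℝ} (hA : A.PosSemidef)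
    (v : ι → ℝ) (n : ℕ) : 0 ≤ (∑ i, ∑ j, v i * v j * A i j ^ n) / n.factorial :=
  div_nonneg (by simpa using (hA.map_pow n).sum_nonneg v) (by positivity)

lemma PosSemidef.sq_sum_le_sum_exp {A : Matrix ι ι ℝ} (hA : A.PosSemidef) (v : ι → ℝ) :
    (∑ i, v i) ^ 2 ≤ ∑ i, ∑ j, v i * v j * Real.exp (A i j) := by
  have h := le_hasSum (hasSum_sum_exp A v) 0 fun n _ => hA.sum_pow_div_factorial_nonneg v n
  simpa [sq, Finset.sum_mul_sum] using h

lemma PosSemidef.sum_pow_mul_eq_zero {A : Matrix ι ι ℝ} (hA : A.PosSemidef) {v : ι → ℝ}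
    (hv : ∑ i, ∑ j, v i * v j * Real.exp (A i j) = 0) (n : ℕ) (i : ι) :
    ∑ j, A i j ^ n * v j = 0 := by
  have h := hasSum_sum_exp A v
  rw [hv, hasSum_zero_iff_of_nonneg (hA.sum_pow_div_factorial_nonneg v)] at h
  have hn : ∑ i, ∑ j, v i * v j * A i j ^ n = 0 := by
    simpa [Nat.factorial_ne_zero] using congrFun h n
  have h0 := ((hA.map_pow n).dotProduct_mulVec_zero_iff v).1 (by
    rw [star_dotProduct_mulVec_eq_sum]; simpa using hn)
  simpa [mulVec, dotProduct] using congrFun h0 i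

/-- The entrywise exponential of a positive semidefinite matrix is definite as soon as the
associated feature vectors are pairwise distinct. -/
lemma PosSemidef.eq_zero_of_sum_exp_eq_zero {A : Matrix ι ι ℝ} (hA : A.PosSemidef)
    (hne : ∀ i j, i ≠ j → 2 * A i j < A i i + A j j) {v : ι → ℝ}
    (hv : ∑ i, ∑ j, v i * v j * Real.exp (A i j) = 0) : v = 0 := by
  classical
  by_contra hv0
  obtain ⟨k, hk⟩ := Function.ne_iff.1 hv0
  obtain ⟨i, hi, hmax⟩ := Finset.exists_max_image (Finset.univ.filter fun i => v i ≠ 0)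
    (fun i => A i i) ⟨k, by simpa using hk⟩
  simp only [Finset.mem_filter, Finset.mem_univ, true_and] at hi hmax
  have hpoly (p : Polynomial ℝ) : ∑ j, p.eval (A i j) * v j = 0 := by
    simp_rw [Polynomial.eval_eq_sum_range, Finset.sum_mul]
    rw [Finset.sum_comm]
    refine Finset.sum_eq_zero fun n _ => ?_
    simp_rw [mul_assoc, ← Finset.mul_sum, hA.sum_pow_mul_eq_zero hv n i, mul_zero]
  have hp := hpoly (∏ a ∈ (Finset.univ.image (A i)).erase (A i i),
    (Polynomial.X - Polynomial.C a))
  rw [Finset.sum_eq_single i, mul_eq_zero, Polynomial.eval_prod, Finset.prod_eq_zero_iff] at hp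
  · rcases hp with ⟨a, ha, h⟩ | h
    · simp only [Polynomial.eval_sub, Polynomial.eval_X, Polynomial.eval_C] at h
      exact (Finset.mem_erase.1 ha).1 (by linarith)
    · exact hi h
  · intro j _ hji
    rcases eq_or_ne (v j) 0 with h | h
    · rw [h, mul_zero]
    have hAij : A i j ≠ A i i := by
      have h1 := hne i j hji.symm
      have h2 := hmax j h
      intro h3
      linarith
    rw [Polynomial.eval_prod, Finset.prod_eq_zero (i := A i j), zero_mul]
    · simp [hAij]
    · simp
  · simp

end Matrix

section LaplaceKernel

variable {ι E : Type*} [Fintype ι] [NormedAddCommGroup E] [InnerProductSpace ℝ E]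

lemma sum_gaussian_defect_nonneg (x : ι → E) (v : ι → ℝ) (s : ℝ) :
    0 ≤ ∑ i, ∑ j, v i * v j * ((1 - Real.exp (-(s * ‖x i‖) ^ 2)) +
      (1 - Real.exp (-(s * ‖x j‖) ^ 2)) - (1 - Real.exp (-(s * ‖x i - x j‖) ^ 2))) := by
  set e : ι → ℝ := fun i => Real.exp (-(s * ‖x i‖) ^ 2)
  have hA : ((2 * s ^ 2) • Matrix.gram ℝ x).PosSemidef :=
    (Matrix.posSemidef_gram (𝕜 := ℝ) (v := x)).smul (by positivity)
  have h := hA.sq_sum_le_sum_exp fun i => v i * e i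
  have hexp (i j : ι) : Real.exp (-(s * ‖x i - x j‖) ^ 2) =
      e i * e j * Real.exp (((2 * s ^ 2) • Matrix.gram ℝ x) i j) := by
    simp only [e, ← Real.exp_add, mul_pow, @norm_sub_sq_real E, Matrix.smul_apply,
      Matrix.gram_apply, smul_eq_mul]
    congr 1
    ring
  have hsum : ∑ i, ∑ j, v i * v j * ((1 - e i) + (1 - e j) -
      (1 - Real.exp (-(s * ‖x i - x j‖) ^ 2))) =
      (∑ i, v i * (1 - e i)) ^ 2 + (∑ i, ∑ j, (v i * e i) * (v j * e j) *
        Real.exp (((2 * s ^ 2) • Matrix.gram ℝ x) i j) - (∑ i, v i * e i) ^ 2) := by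
    simp only [sq (∑ _, _), Finset.sum_mul_sum, ← Finset.sum_add_distrib,
      ← Finset.sum_sub_distrib]
    refine Finset.sum_congr rfl fun i _ => Finset.sum_congr rfl fun j _ => ?_
    rw [hexp]
    ring
  change 0 ≤ ∑ i, ∑ j, v i * v j * ((1 - e i) + (1 - e j) -
      (1 - Real.exp (-(s * ‖x i - x j‖) ^ 2)))
  rw [hsum]
  exact add_nonneg (sq_nonneg _) (sub_nonneg.2 h)

lemma sum_norm_add_norm_sub_norm_sub_nonneg (x : ι → E) (v : ι → ℝ) :
    0 ≤ ∑ i, ∑ j, v i * v j * (‖x i‖ + ‖x j‖ - ‖x i - x j‖) := by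
  refine nonneg_of_mul_nonneg_left ?_ integral_gaussDefect_pos
  let f (r s : ℝ) : ℝ := (1 - Real.exp (-(s * r) ^ 2)) / s ^ 2
  have hf (r : ℝ) : MeasureTheory.Integrable (f r) := integrable_one_sub_exp_div_sq r
  have hint (i j : ι) : MeasureTheory.Integrable fun s =>
      v i * v j * (f ‖x i‖ s + f ‖x j‖ s - f ‖x i - x j‖ s) :=
    (((hf _).add (hf _)).sub (hf _)).const_mul _
  have key : (∑ i, ∑ j, v i * v j * (‖x i‖ + ‖x j‖ - ‖x i - x j‖)) * ∫ s, gaussDefect s =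
      ∫ s, ∑ i, ∑ j, v i * v j * (f ‖x i‖ s + f ‖x j‖ s - f ‖x i - x j‖ s) := by
    rw [MeasureTheory.integral_finsetSum _ fun i _ =>
      MeasureTheory.integrable_finsetSum _ fun j _ => hint i j, Finset.sum_mul]
    refine Finset.sum_congr rfl fun i _ => ?_
    rw [MeasureTheory.integral_finsetSum _ fun j _ => hint i j, Finset.sum_mul]
    refine Finset.sum_congr rfl fun j _ => ?_
    rw [MeasureTheory.integral_const_mul,
      MeasureTheory.integral_sub (f := fun s => f ‖x i‖ s + f ‖x j‖ s) ((hf _).add (hf _)) (hf _),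
      MeasureTheory.integral_add (hf _) (hf _)]
    simp only [f, integral_one_sub_exp_div_sq (norm_nonneg _)]
    ring
  rw [key]
  refine MeasureTheory.integral_nonneg fun s => ?_
  have h := div_nonneg (sum_gaussian_defect_nonneg x v s) (sq_nonneg s)
  simpa only [f, Pi.zero_apply, ← add_div, ← sub_div, ← mul_div_assoc, ← Finset.sum_div] using h

lemma posSemidef_norm_add_norm_sub_norm_sub (x : ι → E) :
    (Matrix.of fun i j => ‖x i‖ + ‖x j‖ - ‖x i - x j‖).PosSemidef := by
  refine .of_dotProduct_mulVec_nonneg ?_ fun v => ?_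
  · ext i j
    simp [norm_sub_rev (x i), add_comm]
  · rw [Matrix.star_dotProduct_mulVec_eq_sum]
    exact sum_norm_add_norm_sub_norm_sub_nonneg x v

/-- The Laplace kernel matrix of finitely many points is positive definite. -/
theorem posDef_exp_neg_norm_sub {x : ι → E} (hx : Function.Injective x) :
    (Matrix.of fun i j => Real.exp (-‖x i - x j‖)).PosDef := by
  have hA := posSemidef_norm_add_norm_sub_norm_sub x
  have hexp (v : ι → ℝ) : ∑ i, ∑ j, v i * v j * Real.exp (-‖x i - x j‖) =
      ∑ i, ∑ j, (v i * Real.exp (-‖x i‖)) * (v j * Real.exp (-‖x j‖)) *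
        Real.exp (Matrix.of (fun i j => ‖x i‖ + ‖x j‖ - ‖x i - x j‖) i j) := by
    refine Finset.sum_congr rfl fun i _ => Finset.sum_congr rfl fun j _ => ?_
    rw [Matrix.of_apply, show -‖x i - x j‖ =
      -‖x i‖ + -‖x j‖ + (‖x i‖ + ‖x j‖ - ‖x i - x j‖) by ring, Real.exp_add, Real.exp_add]
    ring
  refine .of_dotProduct_mulVec_pos ?_ fun v hv => ?_
  · ext i j
    simp [norm_sub_rev (x i)]
  · rw [Matrix.star_dotProduct_mulVec_eq_sum]
    simp only [Matrix.of_apply]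
    rw [hexp]
    refine lt_of_le_of_ne ((sq_nonneg _).trans (hA.sq_sum_le_sum_exp _)) fun h => hv ?_
    have h0 := hA.eq_zero_of_sum_exp_eq_zero (fun i j hij => ?_) h.symm
    · ext i
      simpa [Real.exp_ne_zero] using congrFun h0 i
    · have : 0 < ‖x i - x j‖ := norm_pos_iff.2 (sub_ne_zero.2 (hx.ne hij))
      simp only [Matrix.of_apply, sub_self, norm_zero]
      linarith

/-- The regularized Laplace kernel system has at most one solution. -/
theorem laplace_density_unique {x : ι → E} (hx : Function.Injective x) {c : ℝ} (hc : 0 ≤ c)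
    {b u v : ι → ℝ}
    (hu : ∀ i, c * u i + ∑ k, Real.exp (-‖x i - x k‖) * u k = b i)
    (hv : ∀ i, c * v i + ∑ k, Real.exp (-‖x i - x k‖) * v k = b i) : u = v := by
  classical
  have hM := (posDef_exp_neg_norm_sub hx).posSemidef_add (Matrix.PosSemidef.one.smul hc)
  refine Matrix.mulVec_injective_of_isUnit hM.isUnit ?_
  simp only [Matrix.add_mulVec, Matrix.smul_mulVec, Matrix.one_mulVec]
  ext i
  simpa [Matrix.mulVec, dotProduct] using (hu i).trans (hv i).symm

end LaplaceKernel

/-- Let `𝕏 = {x¹, …, x^m}` be a point cloud of pairwise distinct points in `ℝ^d`,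
`α ≥ 0`, and `R` a rigid transformation (surjective isometry) of `ℝ^d` with
`R(𝕏) = 𝕏`. If `Λ` solves `m α Λ_i + ∑_k exp (-‖x^i - x^k‖) Λ_k = m` for all `i`,
then the signature function `u_𝕏(z) = (1/m) ∑_k Λ_k exp (-‖z - x^k‖)` satisfies
`u_𝕏 (R z) = u_𝕏 z` for every `z`. -/
theorem laplace_signature_function_symmetry (d m : ℕ) (hm : 1 ≤ m)
    (x : Fin m → EuclideanSpace ℝ (Fin d)) (hx : Function.Injective x)
    (α : ℝ) (hα : 0 ≤ α)
    (R : EuclideanSpace ℝ (Fin d) → EuclideanSpace ℝ (Fin d))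
    (hRiso : Isometry R) (hRsurj : Function.Surjective R)
    (hRX : R '' Set.range x = Set.range x)
    (Λ : Fin m → ℝ)
    (hΛ : ∀ i : Fin m,
      (m : ℝ) * α * Λ i + ∑ k : Fin m, Real.exp (-‖x i - x k‖) * Λ k = (m : ℝ)) :
    ∀ z : EuclideanSpace ℝ (Fin d),
      (1 / (m : ℝ)) * ∑ k : Fin m, Λ k * Real.exp (-‖R z - x k‖) =
      (1 / (m : ℝ)) * ∑ k : Fin m, Λ k * Real.exp (-‖z - x k‖) := by
  have hσ (k : Fin m) : ∃ l, x l = R (x k) :=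
    hRX.subset (Set.mem_image_of_mem R (Set.mem_range_self k))
  choose σ hσ using hσ
  have hinj : Function.Injective σ := fun k l h =>
    hx (hRiso.injective (by rw [← hσ, ← hσ, h]))
  have hdist (y z : EuclideanSpace ℝ (Fin d)) : ‖R y - R z‖ = ‖y - z‖ := by
    simpa only [dist_eq_norm] using hRiso.dist_eq y z
  have hbij : Function.Bijective σ := Finite.injective_iff_bijective.1 hinj
  have hΛσ : Λ ∘ σ = Λ := by
    refine laplace_density_unique hx (by positivity : (0 : ℝ) ≤ m * α) (fun i => ?_) hΛ
    refine Eq.trans ?_ (hΛ (σ i))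
    rw [← hbij.sum_comp fun k => Real.exp (-‖x (σ i) - x k‖) * Λ k]
    simp only [hσ, hdist, Function.comp_apply]
  intro z
  rw [← hbij.sum_comp fun k => Λ k * Real.exp (-‖R z - x k‖)]
  simp only [hσ, hdist, ← Function.comp_apply (f := Λ) (g := σ), hΛσ]
end

section
/- Let H be a real Hilbert space and let F : H → ℝ be convex, lower semicontinuous and nonnegative with nonempty zero set C = {u ∈ H : F(u) = 0}. Let u₀ be the unique element of minimal norm of the (closed convex) set C, and for α > 0 let u_α be the unique minimizer of E_α(u) = (1/2)‖u‖² + (1/(2α)) F(u). Then u_α converges to u₀ in the norm of H as α → 0. -/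
/-- Quadratic growth of `v ↦ ‖v‖² / 2 + c F v` around a minimizer. -/
theorem ConvexOn.norm_sub_sq_le_of_forall_le
    {H : Type*} [NormedAddCommGroup H] [InnerProductSpace ℝ H]
    {F : H → ℝ} (hconv : ConvexOn ℝ Set.univ F) {c : ℝ} (hc : 0 ≤ c) {u : H}
    (hu : ∀ v, ‖u‖ ^ 2 / 2 + c * F u ≤ ‖v‖ ^ 2 / 2 + c * F v) (v : H) :
    ‖u - v‖ ^ 2 / 4 + (‖u‖ ^ 2 / 2 + c * F u) ≤ ‖v‖ ^ 2 / 2 + c * F v := by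
  have hmid : F ((1 / 2 : ℝ) • u + (1 / 2 : ℝ) • v) ≤ 1 / 2 * F u + 1 / 2 * F v :=
    hconv.2 (Set.mem_univ u) (Set.mem_univ v) (by norm_num) (by norm_num) (by norm_num)
  have hle := hu ((1 / 2 : ℝ) • u + (1 / 2 : ℝ) • v)
  have hnorm : ‖(1 / 2 : ℝ) • u + (1 / 2 : ℝ) • v‖ ^ 2 = ‖u + v‖ ^ 2 / 4 := by
    rw [← smul_add, norm_smul, mul_pow]
    norm_num
    ring
  have hpar := parallelogram_law_with_norm ℝ u v
  have hmul := mul_le_mul_of_nonneg_left hmid hc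
  nlinarith

/-- As the weight of `F` grows, the value of `F` at the minimizers of `v ↦ ‖v‖² / 2 + c F v`
decreases. -/
theorem apply_le_apply_of_forall_le {H : Type*} [NormedAddCommGroup H] {F : H → ℝ} {c d : ℝ}
    (hcd : c < d) {u w : H}
    (hu : ∀ v, ‖u‖ ^ 2 / 2 + c * F u ≤ ‖v‖ ^ 2 / 2 + c * F v)
    (hw : ∀ v, ‖w‖ ^ 2 / 2 + d * F w ≤ ‖v‖ ^ 2 / 2 + d * F v) : F w ≤ F u := by
  nlinarith [hu w, hw u]

/-- Convergence of the regularization path: if `u₀` is the element of minimal norm of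
the zero set `C = {u | F u = 0}` of a convex, lower semicontinuous, nonnegative
`F : H → ℝ`, and for each `α > 0` the point `uα α` is the minimizer of
`E_α(u) = ‖u‖²/2 + F(u)/(2α)`, then `uα α → u₀` in norm as `α → 0⁺`. -/
theorem regularization_path_converges
    {H : Type*} [NormedAddCommGroup H] [InnerProductSpace ℝ H] [CompleteSpace H]
    (F : H → ℝ) (hconv : ConvexOn ℝ Set.univ F)
    (hlsc : LowerSemicontinuous F) (hnn : ∀ u, 0 ≤ F u)
    (u₀ : H) (hu₀C : F u₀ = 0) (hu₀min : ∀ v : H, F v = 0 → ‖u₀‖ ≤ ‖v‖)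
    (uα : ℝ → H)
    (huα : ∀ α : ℝ, 0 < α → ∀ v : H,
      ‖uα α‖ ^ 2 / 2 + F (uα α) / (2 * α) ≤ ‖v‖ ^ 2 / 2 + F v / (2 * α)) :
    Filter.Tendsto uα (nhdsWithin 0 (Set.Ioi 0)) (nhds u₀) := by
  have hmin : ∀ α : ℝ, 0 < α → ∀ v : H,
      ‖uα α‖ ^ 2 / 2 + (2 * α)⁻¹ * F (uα α) ≤ ‖v‖ ^ 2 / 2 + (2 * α)⁻¹ * F v := by
    intro α hα v
    simpa only [div_eq_inv_mul (F _)] using huα α hα v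
  have hgrowth : ∀ α : ℝ, 0 < α → ∀ v : H, F v ≤ F (uα α) →
      ‖uα α - v‖ ^ 2 ≤ 2 * (‖v‖ ^ 2 - ‖uα α‖ ^ 2) := by
    intro α hα v hv
    have hc : 0 ≤ (2 * α)⁻¹ := by positivity
    have := hconv.norm_sub_sq_le_of_forall_le hc (hmin α hα) v
    have := mul_le_mul_of_nonneg_left hv hc
    linarith
  have hpath : ∀ α β : ℝ, 0 < β → β < α →
      ‖uα α - uα β‖ ^ 2 ≤ 2 * (‖uα β‖ ^ 2 - ‖uα α‖ ^ 2) := by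
    intro α β hβ hβα
    have hα := hβ.trans hβα
    refine hgrowth α hα _ (apply_le_apply_of_forall_le ?_ (hmin α hα) (hmin β hβ))
    gcongr
  have hbase : ∀ α : ℝ, 0 < α → ‖uα α - u₀‖ ^ 2 ≤ 2 * (‖u₀‖ ^ 2 - ‖uα α‖ ^ 2) :=
    fun α hα => hgrowth α hα u₀ (hu₀C.trans_le (hnn _))
  have hanti : AntitoneOn (fun α => ‖uα α‖ ^ 2) (Set.Ioi 0) := by
    intro β hβ α _ hle
    rcases hle.eq_or_lt with rfl | hlt
    · exact le_rfl
    · have := hpath α β hβ hlt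
      have := sq_nonneg ‖uα α - uα β‖
      dsimp only
      linarith
  have hbdd : BddAbove ((fun α => ‖uα α‖ ^ 2) '' Set.Ioi 0) := by
    refine ⟨‖u₀‖ ^ 2, ?_⟩
    rintro _ ⟨α, hα, rfl⟩
    have := hbase α hα
    have := sq_nonneg ‖uα α - u₀‖
    dsimp only
    linarith
  have hnorm := hanti.tendsto_nhdsGT hbdd
  have hdist : ∀ α β : ℝ, 0 < α → 0 < β →
      dist (uα α) (uα β) ≤ √(2 * |‖uα α‖ ^ 2 - ‖uα β‖ ^ 2|) := by
    intro α β hα hβ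
    rw [dist_eq_norm]
    apply Real.le_sqrt_of_sq_le
    rcases lt_trichotomy α β with h | rfl | h
    · rw [norm_sub_rev]
      exact (hpath β α hα h).trans (by gcongr; exact le_abs_self _)
    · simp
    · rw [abs_sub_comm]
      exact (hpath α β hβ h).trans (by gcongr; exact le_abs_self _)
  have hcauchy : Cauchy (Filter.map uα (nhdsWithin 0 (Set.Ioi 0))) := by
    rw [cauchy_map_iff']
    rw [tendsto_uniformity_iff_dist_tendsto_zero]
    have hsub := (hnorm.comp Filter.tendsto_fst).sub (hnorm.comp Filter.tendsto_snd)
    have hlim := (hsub.abs.const_mul 2).sqrt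
    simp only [sub_self, abs_zero, mul_zero, Real.sqrt_zero] at hlim
    refine squeeze_zero' (Filter.Eventually.of_forall fun _ => dist_nonneg) ?_ hlim
    filter_upwards [Filter.prod_mem_prod self_mem_nhdsWithin self_mem_nhdsWithin] with p hp
    exact hdist p.1 p.2 hp.1 hp.2
  obtain ⟨w, hw⟩ := CompleteSpace.complete hcauchy
  have hw : Filter.Tendsto uα (nhdsWithin 0 (Set.Ioi 0)) (nhds w) := hw
  have hFle : ∀ α : ℝ, 0 < α → F (uα α) ≤ α * ‖u₀‖ ^ 2 := by
    intro α hα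
    have h := huα α hα u₀
    rw [hu₀C, zero_div, add_zero] at h
    have h' : F (uα α) / (2 * α) ≤ ‖u₀‖ ^ 2 / 2 := by
      have := sq_nonneg ‖uα α‖
      linarith
    rw [div_le_iff₀ (by positivity)] at h'
    linarith
  have hFw : F w = 0 := by
    refine le_antisymm (le_of_forall_lt fun y hy => ?_) (hnn w)
    have hzero : Filter.Tendsto (fun α : ℝ => α * ‖u₀‖ ^ 2) (nhdsWithin 0 (Set.Ioi 0))
        (nhds 0) := by
      have : Filter.Tendsto (fun α : ℝ => α * ‖u₀‖ ^ 2) (nhds 0) (nhds (0 * ‖u₀‖ ^ 2)) :=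
        Filter.tendsto_id.mul_const _
      rw [zero_mul] at this
      exact this.mono_left nhdsWithin_le_nhds
    obtain ⟨z, hyz, hzw⟩ := exists_between hy
    refine hyz.trans_le (ge_of_tendsto hzero ?_)
    filter_upwards [hw.eventually (hlsc w z hzw), self_mem_nhdsWithin] with α hz hα
    exact hz.le.trans (hFle α hα)
  have hlimit : ‖w - u₀‖ ^ 2 ≤ 2 * (‖u₀‖ ^ 2 - ‖w‖ ^ 2) := by
    refine le_of_tendsto_of_tendsto ((hw.sub_const u₀).norm.pow 2)
      (((hw.norm.pow 2).const_sub _).const_mul 2) ?_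
    filter_upwards [self_mem_nhdsWithin] with α hα using hbase α hα
  have hmono : ‖u₀‖ ^ 2 ≤ ‖w‖ ^ 2 := by
    gcongr
    exact hu₀min w hFw
  have hwu : w = u₀ := by
    rw [← sub_eq_zero, ← norm_eq_zero, ← sq_eq_zero_iff]
    exact le_antisymm (by linarith) (sq_nonneg _)
  exact hwu ▸ hw
end

section
/- Fix m ≥ 1, d ≥ 1 and α > 0. For a tuple x = (x¹, …, x^m) ∈ (ℝ^d)^m, let M(x) = [exp(−‖x^i − x^k‖²)]_{1≤i,k≤m}, let Λ(x) ∈ ℝ^m be the unique solution of (mα·I + M(x))Λ = m·𝟙 (which exists since M(x) is positive semidefinite and α > 0), and define u_x(z) = (1/m) ∑_{k=1}^m Λ_k(x) exp(−‖z − x^k‖²) for z ∈ ℝ^d. Then the map x ↦ u_x is continuous from (ℝ^d)^m into L²(ℝ^d); that is, the signature function depends continuously on the point cloud. -/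
open MeasureTheory

theorem exp_mul_exp_eq_exp_midpoint {V : Type*} [NormedAddCommGroup V]
    [InnerProductSpace ℝ V] (x y z : V) :
    Real.exp (-2 * ‖z - x‖ ^ 2) * Real.exp (-2 * ‖z - y‖ ^ 2) =
      Real.exp (-‖x - y‖ ^ 2) * Real.exp (-4 * ‖z - (1 / 2 : ℝ) • (x + y)‖ ^ 2) := by
  rw [← Real.exp_add, ← Real.exp_add]
  congr 1
  have h := parallelogram_law_with_norm ℝ (z - x) (z - y)
  have h₁ : z - x + (z - y) = (2 : ℝ) • (z - (1 / 2 : ℝ) • (x + y)) := by module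
  have h₂ : z - x - (z - y) = -(x - y) := by abel
  rw [h₁, h₂, norm_smul, norm_neg, Real.norm_eq_abs, abs_two] at h
  linarith

section GaussKernel

variable {V : Type*} [NormedAddCommGroup V] [InnerProductSpace ℝ V] [FiniteDimensional ℝ V]
  [MeasurableSpace V] [BorelSpace V]

theorem integral_exp_neg_mul_sq_norm_pos {b : ℝ} (hb : 0 < b) :
    0 < ∫ v : V, Real.exp (-b * ‖v‖ ^ 2) := by
  rw [GaussianFourier.integral_rexp_neg_mul_sq_norm hb]
  positivity

theorem integrable_exp_neg_mul_sq_norm {b : ℝ} (hb : 0 < b) :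
    Integrable fun v : V => Real.exp (-b * ‖v‖ ^ 2) :=
  Integrable.of_integral_ne_zero (integral_exp_neg_mul_sq_norm_pos hb).ne'

theorem integrable_exp_mul_exp (x y : V) :
    Integrable fun z : V => Real.exp (-2 * ‖z - x‖ ^ 2) * Real.exp (-2 * ‖z - y‖ ^ 2) := by
  simp_rw [exp_mul_exp_eq_exp_midpoint]
  exact ((integrable_exp_neg_mul_sq_norm four_pos).comp_sub_right _).const_mul _

theorem integral_exp_mul_exp (x y : V) :
    ∫ z : V, Real.exp (-2 * ‖z - x‖ ^ 2) * Real.exp (-2 * ‖z - y‖ ^ 2) =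
      Real.exp (-‖x - y‖ ^ 2) * ∫ z : V, Real.exp (-4 * ‖z‖ ^ 2) := by
  simp_rw [exp_mul_exp_eq_exp_midpoint]
  rw [integral_const_mul,
    integral_sub_right_eq_self (fun z : V => Real.exp (-4 * ‖z‖ ^ 2)) ((1 / 2 : ℝ) • (x + y))]

/-- The kernel matrix of the Gauss kernel is positive semidefinite: up to a positive factor it is
the Gram matrix in `L²` of the functions `z ↦ exp (-2 ‖z - x i‖²)`. -/
theorem posSemidef_gauss_kernel {ι : Type*} [Fintype ι] (x : ι → V) :
    (Matrix.of fun i k : ι => Real.exp (-‖x i - x k‖ ^ 2)).PosSemidef := by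
  refine .of_dotProduct_mulVec_nonneg ?_ fun v => ?_
  · ext i k
    simp [norm_sub_rev]
  refine nonneg_of_mul_nonneg_left ?_ (integral_exp_neg_mul_sq_norm_pos (V := V) four_pos)
  have key : (star v ⬝ᵥ (Matrix.of fun i k : ι => Real.exp (-‖x i - x k‖ ^ 2)).mulVec v) *
      ∫ z : V, Real.exp (-4 * ‖z‖ ^ 2) =
      ∫ z : V, (∑ i, v i * Real.exp (-2 * ‖z - x i‖ ^ 2)) ^ 2 := by
    have h (z : V) : (∑ i, v i * Real.exp (-2 * ‖z - x i‖ ^ 2)) ^ 2 =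
        ∑ i, ∑ k, v i * v k *
          (Real.exp (-2 * ‖z - x i‖ ^ 2) * Real.exp (-2 * ‖z - x k‖ ^ 2)) := by
      rw [sq, Finset.sum_mul_sum]
      exact Finset.sum_congr rfl fun i _ => Finset.sum_congr rfl fun k _ => by ring
    simp_rw [h]
    rw [integral_finsetSum _ fun i _ => integrable_finsetSum _ fun k _ =>
      (integrable_exp_mul_exp _ _).const_mul _]
    simp_rw [integral_finsetSum _ fun k _ => (integrable_exp_mul_exp _ _).const_mul _,
      integral_const_mul, integral_exp_mul_exp]
    simp only [dotProduct, Matrix.mulVec, Finset.mul_sum, Finset.sum_mul, Matrix.of_apply,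
      Pi.star_apply, star_trivial]
    exact Finset.sum_congr rfl fun i _ => Finset.sum_congr rfl fun k _ => by ring
  rw [key]
  exact integral_nonneg fun z => sq_nonneg _

theorem posDef_smul_one_add_gauss_kernel {ι : Type*} [Fintype ι] [DecidableEq ι] {c : ℝ}
    (hc : 0 < c) (x : ι → V) :
    (c • (1 : Matrix ι ι ℝ) +
      Matrix.of fun i k : ι => Real.exp (-‖x i - x k‖ ^ 2)).PosDef :=
  (Matrix.PosDef.one.smul hc).add_posSemidef (posSemidef_gauss_kernel x)

theorem memLp_two_exp_neg_sq_norm : MemLp (fun z : V => Real.exp (-‖z‖ ^ 2)) 2 := by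
  rw [memLp_two_iff_integrable_sq (by fun_prop)]
  convert integrable_exp_neg_mul_sq_norm (V := V) two_pos using 2 with z
  rw [← Real.exp_nat_mul]
  push_cast
  ring_nf

end GaussKernel

/-- Translates, with continuously varying weight, of a fixed `Lᵖ` function depend continuously on
the translation in `Lᵖ`. -/
theorem tendsto_eLpNorm_mul_translate_sub {G T : Type*} [AddGroup G] [TopologicalSpace G]
    [IsTopologicalAddGroup G] [MeasurableSpace G] [BorelSpace G] [T2Space G] {μ : Measure G}
    [IsLocallyFiniteMeasure μ] [μ.InnerRegularCompactLTTop] [μ.IsAddRightInvariant]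
    [TopologicalSpace T] {p : ENNReal} [Fact (1 ≤ p)] (hp : p ≠ ⊤)
    {g : G → ℝ} (hg : MemLp g p μ) {c : T → ℝ} (hc : Continuous c)
    {y : T → G} (hy : Continuous y) (t₀ : T) :
    Filter.Tendsto
      (fun t => eLpNorm (fun z => c t * g (z - y t) - c t₀ * g (z - y t₀)) p μ)
      (nhds t₀) (nhds 0) := by
  let s : T → C(G, G) := fun t => ⟨fun z => z - y t, by fun_prop⟩
  have hs : Continuous s := ContinuousMap.continuous_of_continuous_uncurry _ (by
    change Continuous fun q : T × G => q.2 - y q.1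
    fun_prop)
  have hmp (t : T) : MeasurePreserving (s t) μ μ := measurePreserving_sub_right μ (y t)
  have hF : Continuous fun t => c t • Lp.compMeasurePreserving (s t) (hmp t) (hg.toLp g) :=
    hc.smul (continuous_const.compMeasurePreservingLp hs hmp hp)
  have hmem (t : T) : MemLp (fun z => c t * g (z - y t)) p μ :=
    (hg.comp_measurePreserving (hmp t)).const_mul (c t)
  exact (Lp.tendsto_Lp_iff_tendsto_eLpNorm'' (fun t z => c t * g (z - y t)) hmem _ (hmem t₀)).1
    (hF.tendsto t₀)

/-- The solution of a linear system with continuously varying invertible matrix is continuous. -/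
theorem continuous_of_mulVec_eq {T ι : Type*} [TopologicalSpace T] [Fintype ι] [DecidableEq ι]
    {A : T → Matrix ι ι ℝ} (hA : Continuous A) (hdet : ∀ t, (A t).det ≠ 0)
    {v b : T → ι → ℝ} (hb : Continuous b) (h : ∀ t, (A t).mulVec (v t) = b t) :
    Continuous v := by
  have hv : v = fun t => ((A t).det)⁻¹ • (A t).adjugate.mulVec (b t) := by
    funext t
    rw [← h t, Matrix.mulVec_mulVec, Matrix.adjugate_mul, Matrix.smul_mulVec, Matrix.one_mulVec,
      inv_smul_smul₀ (hdet t)]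
  rw [hv]
  exact (hA.matrix_det.inv₀ hdet).smul (hA.matrix_adjugate.matrix_mulVec hb)

/-- Continuous dependence of the (regularized, `α > 0`) Gauss-kernel signature function
on the point cloud: if for each tuple `x = (x¹, …, x^m)` the density `Λ x` solves
`(mα·I + M(x)) Λ = m·𝟙` with `M(x) = [exp (-‖x^i - x^k‖²)]`, then the map sending the
point cloud to the signature function `z ↦ (1/m) ∑ₖ Λₖ exp (-‖z - x^k‖²)` is continuous
into `L²(ℝ^d)`. -/
theorem signature_function_continuous_in_cloud (d m : ℕ) (hm : 1 ≤ m) (hd : 1 ≤ d)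
    (α : ℝ) (hα : 0 < α)
    (Λ : (Fin m → EuclideanSpace ℝ (Fin d)) → Fin m → ℝ)
    (hΛ : ∀ x : Fin m → EuclideanSpace ℝ (Fin d),
      (((m : ℝ) * α) • (1 : Matrix (Fin m) (Fin m) ℝ) +
        Matrix.of fun i k : Fin m => Real.exp (-‖x i - x k‖ ^ 2)).mulVec (Λ x) =
        fun _ => (m : ℝ)) :
    ∀ x₀ : Fin m → EuclideanSpace ℝ (Fin d),
      Filter.Tendsto
        (fun x : Fin m → EuclideanSpace ℝ (Fin d) =>
          eLpNorm
            (fun z : EuclideanSpace ℝ (Fin d) =>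
              (1 / (m : ℝ)) * ∑ k : Fin m, Λ x k * Real.exp (-‖z - x k‖ ^ 2) -
                (1 / (m : ℝ)) * ∑ k : Fin m, Λ x₀ k * Real.exp (-‖z - x₀ k‖ ^ 2))
            2 volume)
        (nhds x₀) (nhds 0) := by
  intro x₀
  have hm' : (0 : ℝ) < m := by exact_mod_cast hm
  have hΛc : Continuous Λ :=
    continuous_of_mulVec_eq
      (continuous_const.add (continuous_matrix fun i k => by simp only [Matrix.of_apply]; fun_prop))
      (fun x => (posDef_smul_one_add_gauss_kernel (mul_pos hm' hα) x).det_pos.ne')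
      continuous_const hΛ
  have hterm (k : Fin m) := tendsto_eLpNorm_mul_translate_sub (μ := volume) ENNReal.ofNat_ne_top
    (memLp_two_exp_neg_sq_norm (V := EuclideanSpace ℝ (Fin d)))
    (c := fun x => 1 / (m : ℝ) * Λ x k) (y := fun x => x k)
    (by fun_prop) (continuous_apply k) x₀
  have hsum := tendsto_finsetSum Finset.univ fun k _ => hterm k
  rw [Finset.sum_const_zero] at hsum
  refine tendsto_of_tendsto_of_tendsto_of_le_of_le tendsto_const_nhds hsum
    (fun _ => zero_le) fun x => ?_
  refine le_trans (le_of_eq ?_) (eLpNorm_sum_le (fun k _ => ?_) one_le_two)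
  · congr 1
    funext z
    simp only [Finset.sum_apply, Finset.mul_sum, Finset.sum_sub_distrib, mul_assoc]
  · exact Continuous.aestronglyMeasurable (by fun_prop)
end
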